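/- Let α,β,γ,δ>-1. Then there exist constants C>0 and N such that for every ψ∈W_AC(-1,1) and every integer n≥N, |∫_{-1}^1 (1+x)^γ (1-x)^δ P_n^{(α,β)}(x) ψ(x) dx| ≤ C ‖ψ‖_{W_AC(-1,1)} · n^{-min{2δ-α+2, 2γ-β+2, 3/2}}. -/

import Mathlib

open MeasureTheory Set

/-- Jacobi polynomial via Rodrigues' formula. -/
noncomputable def jacobiP (a b : ℝ) (n : ℕ) (x : ℝ) : ℝ :=
  ((-1 : ℝ) ^ n / (2 ^ n * (n.factorial : ℝ))) * (1 - x) ^ (-a) * (1 + x) ^ (-b) *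
    iteratedDeriv n (fun y => (1 - y) ^ ((n : ℝ) + a) * (1 + y) ^ ((n : ℝ) + b)) x

/-- ψ is absolutely continuous on [a,b] with integrable derivative (FTC characterization). -/
def IsWAC (a b : ℝ) (psi : ℝ → ℝ) : Prop :=
  MeasureTheory.IntegrableOn (deriv psi) (Set.Ioo a b) ∧
  ∀ x ∈ Set.Icc a b, psi x = psi a + ∫ t in a..x, deriv psi t

/-- The W_AC norm: ‖ψ‖_∞ + ‖ψ'‖_{L¹}. -/
noncomputable def wacNorm (a b : ℝ) (psi : ℝ → ℝ) : ℝ :=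
  (⨆ x : Set.Icc a b, |psi (x : ℝ)|) + ∫ t in a..b, |deriv psi t|



namespace VdC
set_option linter.unusedSimpArgs false
set_option linter.unnecessarySeqFocus false
open Polynomial in
noncomputable def Qr (a b : ℝ) : ℕ → Polynomial ℝ
  | 0 => 1
  | m + 1 => (C (b - a) - C (a + b - 2 * m) * X) * Qr a b m + (1 - X ^ 2) * derivative (Qr a b m)

open Polynomial in
lemma Qr_deriv (a b : ℝ) (m : ℕ) :
    derivative (Qr a b (m + 1)) = - C ((m + 1) * (a + b - m)) * Qr a b m := by
  induction m with
  | zero => simp [Qr]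
  | succ k ih =>
    rw [Qr, derivative_add, derivative_mul, derivative_mul, ih]
    have h2 : Qr a b (k + 1) = (C (b - a) - C (a + b - 2 * k) * X) * Qr a b k
      + (1 - X ^ 2) * derivative (Qr a b k) := rfl
    simp only [derivative_mul, derivative_sub, derivative_C, derivative_X, derivative_neg,
      derivative_one, derivative_X_pow, derivative_natCast, derivative_ofNat, map_mul, map_add, map_sub, map_natCast, map_one,
      C_ofNat, Nat.cast_add, Nat.cast_one] at h2 ⊢
    rw [h2]
    push_cast
    simp only [map_ofNat, Nat.add_one_sub_one, pow_one]
    ring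

open Polynomial in
lemma Qr_ode (a b : ℝ) (m : ℕ) :
    (1 - X ^ 2) * derivative (derivative (Qr a b m)) +
      (C (b - a) - C (a + b - 2 * m + 2) * X) * derivative (Qr a b m) +
      C (m * (a + b - m + 1)) * Qr a b m = 0 := by
  cases m with
  | zero => simp [Qr]
  | succ k =>
    rw [Qr_deriv]
    have h2 : Qr a b (k + 1) = (C (b - a) - C (a + b - 2 * k) * X) * Qr a b k
      + (1 - X ^ 2) * derivative (Qr a b k) := rfl
    rw [h2]
    simp only [derivative_mul, derivative_sub, derivative_C, derivative_X, derivative_neg,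
      derivative_one, derivative_X_pow, derivative_natCast, derivative_ofNat, map_mul, map_add, map_sub, map_natCast, map_one,
      Nat.cast_add, Nat.cast_one, map_ofNat]
    ring

lemma Qr_one (a b : ℝ) (m : ℕ) :
    (Qr a b m).eval 1 = (-2) ^ m * ∏ k ∈ Finset.range m, (a - k) := by
  induction m with
  | zero => simp [Qr]
  | succ k ih =>
    rw [Qr, Finset.prod_range_succ, pow_succ]
    simp [ih]
    ring

lemma hasDerivAt_wt (a b x : ℝ) (h : x ∈ Ioo (-1 : ℝ) 1) :
    HasDerivAt (fun y : ℝ => (1 - y) ^ a * (1 + y) ^ b)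
      ((1 - x) ^ (a - 1) * (1 + x) ^ (b - 1) * (-a * (1 + x) + b * (1 - x))) x := by
  have h1 : 0 < 1 - x := by linarith [h.2]
  have h2 : 0 < 1 + x := by linarith [h.1]
  have d1 := ((hasDerivAt_id x).const_sub 1).rpow_const (p := a) (Or.inl h1.ne')
  have d2 := ((hasDerivAt_id x).const_add 1).rpow_const (p := b) (Or.inl h2.ne')
  have := d1.mul d2
  refine this.congr_deriv ?_
  simp only [id]
  have e1 : (1 - x) ^ a = (1 - x) ^ (a - 1) * (1 - x) := by
    rw [← Real.rpow_add_one h1.ne']; simp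
  have e2 : (1 + x) ^ b = (1 + x) ^ (b - 1) * (1 + x) := by
    rw [← Real.rpow_add_one h2.ne']; simp
  rw [e1, e2]; ring

lemma iter_eq (a b : ℝ) (m : ℕ) : ∀ x ∈ Ioo (-1 : ℝ) 1,
    iteratedDeriv m (fun y : ℝ => (1 - y) ^ a * (1 + y) ^ b) x =
      (1 - x) ^ (a - m) * (1 + x) ^ (b - m) * (Qr a b m).eval x := by
  induction m with
  | zero => intro x _; simp [Qr]
  | succ k ih =>
    intro x hx
    rw [iteratedDeriv_succ]
    have h1 : 0 < 1 - x := by linarith [hx.2]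
    have h2 : 0 < 1 + x := by linarith [hx.1]
    have he : iteratedDeriv k (fun y : ℝ => (1 - y) ^ a * (1 + y) ^ b) =ᶠ[nhds x]
        fun x => (1 - x) ^ (a - k) * (1 + x) ^ (b - k) * (Qr a b k).eval x := by
      filter_upwards [isOpen_Ioo.mem_nhds hx] with y hy using ih y hy
    rw [he.deriv_eq]
    have := ((hasDerivAt_wt (a - k) (b - k) x hx).mul ((Qr a b k).hasDerivAt x)).deriv
    refine Eq.trans this ?_
    have e1 : (1 - x) ^ (a - k) = (1 - x) ^ (a - k - 1) * (1 - x) := by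
      rw [← Real.rpow_add_one h1.ne']; simp
    have e2 : (1 + x) ^ (b - k) = (1 + x) ^ (b - k - 1) * (1 + x) := by
      rw [← Real.rpow_add_one h2.ne']; simp
    rw [e1, e2, Qr]
    push_cast
    simp only [Polynomial.eval_add, Polynomial.eval_mul, Polynomial.eval_sub, Polynomial.eval_C,
      Polynomial.eval_X, Polynomial.eval_one, Polynomial.eval_pow, ← sub_sub]
    ring

lemma prod_bound (α : ℝ) (hα : -1 < α) (n : ℕ) (hn : 1 ≤ n) :
    |(∏ k ∈ Finset.range n, ((n : ℝ) + α - k)) / n.factorial| ≤ Real.exp |α| * (n : ℝ) ^ α := by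
  have hn0 : (0 : ℝ) < n := by exact_mod_cast hn
  have e : (∏ k ∈ Finset.range n, ((n : ℝ) + α - k)) / n.factorial
      = ∏ k ∈ Finset.range n, (1 + α / (k + 1 : ℝ)) := by
    rw [← Finset.prod_range_add_one_eq_factorial, ← Finset.prod_range_reflect]
    push_cast
    rw [← Finset.prod_div_distrib]
    refine Finset.prod_congr rfl fun k hk => ?_
    have hk' := Finset.mem_range.1 hk
    have : ((n - 1 - k : ℕ) : ℝ) = n - 1 - k := by
      rw [Nat.cast_sub (by omega), Nat.cast_sub hn]; simp
    rw [this]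
    have : (k : ℝ) + 1 ≠ 0 := by positivity
    field_simp
    ring
  have hpos : ∀ k : ℕ, 0 < 1 + α / (k + 1 : ℝ) := by
    intro k
    have hk : (0 : ℝ) < (k : ℝ) + 1 := by positivity
    have : 1 + α / (k + 1 : ℝ) = (k + 1 + α) / (k + 1) := by field_simp
    rw [this]
    apply div_pos _ hk
    have : (0:ℝ) ≤ k := by positivity
    linarith
  rw [e, abs_of_pos (Finset.prod_pos fun k _ => hpos k)]
  have h1 : ∏ k ∈ Finset.range n, (1 + α / (k + 1 : ℝ)) ≤ Real.exp (α * (harmonic n : ℝ)) := by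
    rw [harmonic]
    push_cast
    rw [Finset.mul_sum, Real.exp_sum]
    refine Finset.prod_le_prod (fun k _ => (hpos k).le) fun k _ => ?_
    have := Real.add_one_le_exp (α / (k + 1 : ℝ))
    rw [← div_eq_mul_inv]
    linarith
  refine h1.trans ?_
  rw [Real.rpow_def_of_pos hn0, ← Real.exp_add]
  apply Real.exp_le_exp.2
  rcases le_total 0 α with h | h
  · rw [abs_of_nonneg h]
    have := harmonic_le_one_add_log n
    nlinarith
  · have h3 := log_add_one_le_harmonic n
    have h4 : Real.log n ≤ Real.log ((n + 1 : ℕ) : ℝ) := Real.log_le_log hn0 (by push_cast; linarith)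
    have := abs_nonneg α
    nlinarith


lemma jacobi_poly (α β : ℝ) (hα : -1 < α) (n : ℕ) (hn : 1 ≤ n) : ∃ Q : Polynomial ℝ,
    (∀ x ∈ Ioo (-1 : ℝ) 1, jacobiP α β n x = Q.eval x) ∧
    |Q.eval 1| ≤ Real.exp |α| * (n : ℝ) ^ α ∧
    ∀ x : ℝ, (1 - x ^ 2) * Q.derivative.derivative.eval x +
      (β - α - (α + β + 2) * x) * Q.derivative.eval x
        + (n * (n + α + β + 1)) * Q.eval x = 0 := by
  refine ⟨Polynomial.C ((-1 : ℝ) ^ n / (2 ^ n * (n.factorial : ℝ))) * Qr (n + α) (n + β) n, ?_, ?_, ?_⟩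
  · intro x hx
    have h1 : 0 < 1 - x := by linarith [hx.2]
    have h2 : 0 < 1 + x := by linarith [hx.1]
    rw [jacobiP, iter_eq _ _ _ x hx]
    simp only [Polynomial.eval_mul, Polynomial.eval_C, add_sub_cancel_left]
    rw [Real.rpow_neg h1.le, Real.rpow_neg h2.le]
    have := (Real.rpow_pos_of_pos h1 α).ne'
    have := (Real.rpow_pos_of_pos h2 β).ne'
    field_simp
  · have := prod_bound α hα n hn
    convert this using 2
    rw [Polynomial.eval_mul, Polynomial.eval_C, Qr_one]
    have : ((-1 : ℝ)) ^ n * (-2) ^ n = 2 ^ n := by rw [← mul_pow]; norm_num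
    have h3 : ((2:ℝ)) ^ n ≠ 0 := by positivity
    have h4 : (n.factorial : ℝ) ≠ 0 := by positivity
    field_simp
    rw [← this]
  · intro x
    have := congrArg (Polynomial.eval x) (Qr_ode (n + α) (n + β) n)
    simp only [Polynomial.derivative_C_mul]
    simp only [Polynomial.eval_add, Polynomial.eval_mul, Polynomial.eval_sub, Polynomial.eval_C,
      Polynomial.eval_X, Polynomial.eval_one, Polynomial.eval_pow, Polynomial.eval_zero] at this ⊢
    linear_combination ((-1 : ℝ) ^ n / (2 ^ n * (n.factorial : ℝ))) * this

lemma jacobi_symm (α β : ℝ) (n : ℕ) (x : ℝ) :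
    jacobiP α β n (-x) = (-1) ^ n * jacobiP β α n x := by
  have := iteratedDeriv_comp_neg n (fun y : ℝ => (1 - y) ^ ((n : ℝ) + α) * (1 + y) ^ ((n : ℝ) + β)) x
  have e : (fun y : ℝ => (1 - -y) ^ ((n : ℝ) + α) * (1 + -y) ^ ((n : ℝ) + β)) =
    fun y : ℝ => (1 - y) ^ ((n : ℝ) + β) * (1 + y) ^ ((n : ℝ) + α) := by
    funext y; rw [mul_comm]; congr 2 <;> ring
  simp only [jacobiP]
  rw [e] at this
  rw [this]
  have h : ((-1 : ℝ)) ^ n * (-1) ^ n = 1 := by rw [← mul_pow]; norm_num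
  rw [sub_neg_eq_add, ← sub_eq_add_neg, smul_eq_mul]
  linear_combination (-((-1 : ℝ) ^ n / (2 ^ n * (n.factorial : ℝ))) * (1 + x) ^ (-α) * (1 - x) ^ (-β) * iteratedDeriv n (fun y => (1 - y) ^ ((n : ℝ) + α) * (1 + y) ^ ((n : ℝ) + β)) (-x)) * h


lemma compare (Φ Ψ Φ' Ψ' : ℝ → ℝ) (a b : ℝ) (hab : a ≤ b) (cΦ : ContinuousOn Φ (Icc a b))
    (cΨ : ContinuousOn Ψ (Icc a b)) (dΦ : ∀ x ∈ Ioo a b, HasDerivAt Φ (Φ' x) x)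
    (dΨ : ∀ x ∈ Ioo a b, HasDerivAt Ψ (Ψ' x) x) (h : ∀ x ∈ Ioo a b, |Φ' x| ≤ Ψ' x) :
    |Φ b - Φ a| ≤ Ψ b - Ψ a := by
  have m1 : MonotoneOn (fun x => Ψ x - Φ x) (Icc a b) := by
    refine monotoneOn_of_hasDerivWithinAt_nonneg (f' := fun x => Ψ' x - Φ' x) (convex_Icc a b) (cΨ.sub cΦ) ?_ ?_
    · intro x hx
      rw [interior_Icc] at hx
      exact ((dΨ x hx).sub (dΦ x hx)).hasDerivWithinAt
    · intro x hx
      rw [interior_Icc] at hx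
      have := (abs_le.1 (h x hx)).2
      linarith
  have m2 : MonotoneOn (fun x => Ψ x + Φ x) (Icc a b) := by
    refine monotoneOn_of_hasDerivWithinAt_nonneg (f' := fun x => Ψ' x + Φ' x) (convex_Icc a b) (cΨ.add cΦ) ?_ ?_
    · intro x hx
      rw [interior_Icc] at hx
      exact ((dΨ x hx).add (dΦ x hx)).hasDerivWithinAt
    · intro x hx
      rw [interior_Icc] at hx
      have := (abs_le.1 (h x hx)).1
      linarith
  have h1 := m1 (left_mem_Icc.2 hab) (right_mem_Icc.2 hab) hab
  have h2 := m2 (left_mem_Icc.2 hab) (right_mem_Icc.2 hab) hab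
  simp only at h1 h2
  rw [abs_le]
  constructor <;> linarith

lemma one_add_rpow_le (s x : ℝ) (h0 : 0 ≤ x) (h1 : x ≤ 1) : (1 + x) ^ s ≤ 2 ^ |s| := by
  calc (1 + x) ^ s ≤ (1 + x) ^ |s| := Real.rpow_le_rpow_of_exponent_le (by linarith) (le_abs_self s)
    _ ≤ 2 ^ |s| := Real.rpow_le_rpow (by linarith) (by linarith) (abs_nonneg s)

lemma one_le_add_rpow (s x : ℝ) (h0 : 0 ≤ x) (h1 : x ≤ 1) : 1 ≤ 2 ^ |s| * (1 + x) ^ s := by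
  have h := one_add_rpow_le (-s) x h0 h1
  rw [abs_neg, Real.rpow_neg (by linarith)] at h
  have hp : 0 < (1 + x) ^ s := Real.rpow_pos_of_pos (by linarith) s
  rw [inv_le_iff_one_le_mul₀ hp] at h
  exact h

def ODE (α β l : ℝ) (Q : Polynomial ℝ) : Prop :=
  ∀ x : ℝ, (1 - x ^ 2) * Q.derivative.derivative.eval x +
      (β - α - (α + β + 2) * x) * Q.derivative.eval x + l * Q.eval x = 0

lemma near (α β : ℝ) (hα : -1 < α) (hβ : -1 < β) : ∃ c K : ℝ, 0 < c ∧ c < 1 ∧ 0 < K ∧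
    ∀ n l : ℝ, 1 ≤ n → 0 < l → l ≤ 2 * n ^ 2 → ∀ Q, ODE α β l Q →
      (∀ x ∈ Icc (1 - c / n ^ 2) 1, |Q.eval x| ≤ 2 * |Q.eval 1|) ∧
      (∀ x ∈ Ico (1 - c / n ^ 2) 1, |Q.derivative.eval x| ≤ K * n ^ 2 * |Q.eval 1|) := by
  obtain ⟨K0, hK0d⟩ : ∃ K0 : ℝ, K0 = 2 ^ |β| / (α + 1) := ⟨_, rfl⟩
  have hα1 : 0 < α + 1 := by linarith
  have hC0 : (0 : ℝ) < 2 ^ |β| := by positivity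
  have hK0 : 0 < K0 := by rw [hK0d]; positivity
  obtain ⟨c, hcd⟩ : ∃ c : ℝ, c = min (1 / 2) (1 / (4 * K0)) := ⟨_, rfl⟩
  have hc0 : 0 < c := by rw [hcd]; positivity
  have hc1 : c ≤ 1 / 2 := by rw [hcd]; exact min_le_left _ _
  have hc2 : c * (4 * K0) ≤ 1 := by
    rw [← le_div_iff₀ (by positivity), hcd]; exact min_le_right _ _
  refine ⟨c, 4 * K0, hc0, by linarith, by positivity, ?_⟩
  intro n l hn hl hln Q hQ
  have hn2 : 1 ≤ n ^ 2 := by nlinarith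
  have hcn : c / n ^ 2 ≤ 1 / 2 := by
    rw [div_le_iff₀ (by positivity)]; nlinarith
  have hcn0 : 0 < c / n ^ 2 := by positivity
  set x0 := 1 - c / n ^ 2 with hx0
  have hx0p : 0 < x0 := by linarith
  have hx01 : x0 < 1 := by linarith
  obtain ⟨xm, hxm, hM⟩ := isCompact_Icc.exists_isMaxOn (nonempty_Icc.2 hx01.le)
    (f := fun x => |Q.eval x|) (Q.continuous.abs.continuousOn)
  set M := |Q.eval xm| with hMd
  have hM' : ∀ x ∈ Icc x0 1, |Q.eval x| ≤ M := fun x hx => hM hx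
  have hM0 : 0 ≤ M := abs_nonneg _
  have hder : ∀ x ∈ Ico x0 1, |Q.derivative.eval x| ≤ l * M * K0 := by
    intro x hx
    have hc := compare (fun t => (1 - t) ^ (α + 1) * (1 + t) ^ (β + 1) * Q.derivative.eval t)
      (fun t => - (l * M * K0) * (1 - t) ^ (α + 1))
      (fun t => - l * ((1 - t) ^ α * (1 + t) ^ β) * Q.eval t)
      (fun t => l * M * 2 ^ |β| * (1 - t) ^ α) x 1 hx.2.le ?_ ?_ ?_ ?_ ?_
    · simp only [sub_self] at hc
      rw [Real.zero_rpow hα1.ne'] at hc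
      simp only [zero_mul, mul_zero, zero_sub, abs_neg, abs_mul] at hc
      have h1 : 0 < (1 - x) ^ (α + 1) := Real.rpow_pos_of_pos (by linarith [hx.2]) _
      have h2 : 1 ≤ (1 + x) ^ (β + 1) := Real.one_le_rpow (by linarith [hx.1]) (by linarith)
      rw [abs_of_pos h1, abs_of_pos (by linarith)] at hc
      have h3 : (1 - x) ^ (α + 1) * |Q.derivative.eval x| ≤ (1 - x) ^ (α + 1) * (l * M * K0) := by
        have : (1 - x) ^ (α + 1) * |Q.derivative.eval x| ≤
            (1 - x) ^ (α + 1) * (1 + x) ^ (β + 1) * |Q.derivative.eval x| := by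
          apply mul_le_mul_of_nonneg_right _ (abs_nonneg _)
          nlinarith
        linarith
      exact le_of_mul_le_mul_left h3 h1
    · refine ContinuousOn.mul (ContinuousOn.mul ?_ ?_) (Polynomial.continuous _).continuousOn
      · exact (continuousOn_const.sub continuousOn_id).rpow_const (fun t _ => Or.inr hα1.le)
      · exact (continuousOn_const.add continuousOn_id).rpow_const (fun t _ => Or.inr (by linarith))
    · exact continuousOn_const.mul
        ((continuousOn_const.sub continuousOn_id).rpow_const (fun t _ => Or.inr hα1.le))
    · intro t ht
      have ht' : t ∈ Ioo (-1 : ℝ) 1 := ⟨by linarith [ht.1, hx.1], ht.2⟩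
      have := (hasDerivAt_wt (α + 1) (β + 1) t ht').mul (Q.derivative.hasDerivAt t)
      refine this.congr_deriv ?_
      have h1 : 0 < 1 - t := by linarith [ht'.2]
      have h2 : 0 < 1 + t := by linarith [ht'.1]
      rw [add_sub_cancel_right, add_sub_cancel_right, Real.rpow_add_one h1.ne', Real.rpow_add_one h2.ne']
      linear_combination ((1 - t) ^ α * (1 + t) ^ β) * hQ t
    · intro t ht
      have h1 : 0 < 1 - t := by linarith [ht.2]
      have d1 := (((hasDerivAt_id t).const_sub 1).rpow_const (p := α + 1) (Or.inl h1.ne')).const_mul (- (l * M * K0))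
      refine d1.congr_deriv ?_
      simp only [id, add_sub_cancel_right]
      rw [hK0d]
      field_simp
    · intro t ht
      have h1 : 0 < (1 - t) ^ α := Real.rpow_pos_of_pos (by linarith [ht.2]) _
      have h2 : 0 < (1 + t) ^ β := Real.rpow_pos_of_pos (by linarith [ht.1, hx.1]) _
      have h3 := one_add_rpow_le β t (by linarith [ht.1, hx.1]) ht.2.le
      have h4 := hM' t ⟨by linarith [ht.1, hx.1], ht.2.le⟩
      rw [abs_mul, abs_mul, abs_neg, abs_of_pos hl, abs_of_pos (mul_pos h1 h2)]
      calc l * ((1 - t) ^ α * (1 + t) ^ β) * |Q.eval t| ≤ l * ((1 - t) ^ α * 2 ^ |β|) * M := by gcongr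
        _ = _ := by ring
  have hlK : l * K0 * (c / n ^ 2) ≤ 1 / 2 := by
    calc l * K0 * (c / n ^ 2) ≤ 2 * n ^ 2 * K0 * (c / n ^ 2) := by gcongr
      _ = c * (4 * K0) / 2 := by field_simp; ring
      _ ≤ 1 / 2 := by linarith
  have hMb : M ≤ 2 * |Q.eval 1| := by
    have hc := compare (fun t => Q.eval t) (fun t => l * M * K0 * t) (fun t => Q.derivative.eval t)
      (fun _ => l * M * K0) xm 1 hxm.2 Q.continuous.continuousOn
      (continuousOn_const.mul continuousOn_id) (fun t _ => Q.hasDerivAt t)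
      (fun t _ => by simpa using (hasDerivAt_id t).const_mul (l * M * K0))
      (fun t ht => hder t ⟨by linarith [ht.1, hxm.1], ht.2⟩)
    have h1 : |Q.eval xm| - |Q.eval 1| ≤ |Q.eval 1 - Q.eval xm| := by
      rw [abs_sub_comm]; exact abs_sub_abs_le_abs_sub _ _
    have h2 : l * M * K0 * 1 - l * M * K0 * xm ≤ M * (1 / 2) := by
      calc l * M * K0 * 1 - l * M * K0 * xm = M * (l * K0 * (1 - xm)) := by ring
        _ ≤ M * (l * K0 * (c / n ^ 2)) := by
          gcongr; linarith [hxm.1]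
        _ ≤ _ := by gcongr
    rw [← hMd] at h1
    linarith
  refine ⟨fun x hx => (hM' x hx).trans hMb, fun x hx => (hder x hx).trans ?_⟩
  calc l * M * K0 ≤ 2 * n ^ 2 * (2 * |Q.eval 1|) * K0 := by gcongr
    _ = _ := by ring

noncomputable def hh (α β x : ℝ) : ℝ := -(α / 2 + 1 / 4) / (1 - x) + (β / 2 + 1 / 4) / (1 + x)

noncomputable def En (α β L : ℝ) (Q : Polynomial ℝ) (x : ℝ) : ℝ :=
  (1 - x) ^ (α + 1 / 2) * (1 + x) ^ (β + 1 / 2) *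
    ((1 - x ^ 2) * (Q.derivative.eval x + hh α β x * Q.eval x) ^ 2 + L ^ 2 * Q.eval x ^ 2)

noncomputable def qq (α β x : ℝ) : ℝ :=
  (1 / 4 - α ^ 2) / (2 * (1 - x)) + (1 / 4 - β ^ 2) / (2 * (1 + x)) + ((α + β + 1) / 2) ^ 2

lemma En_deriv (α β L : ℝ) (Q : Polynomial ℝ) (hQ : ODE α β (L ^ 2) Q) (x : ℝ)
    (hx : x ∈ Ioo (-1 : ℝ) 1) : HasDerivAt (En α β L Q)
      (-2 * qq α β x * ((1 - x) ^ (α + 1 / 2) * (1 + x) ^ (β + 1 / 2)) * Q.eval x *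
        (Q.derivative.eval x + hh α β x * Q.eval x)) x := by
  have h1 : 0 < 1 - x := by linarith [hx.2]
  have h2 : 0 < 1 + x := by linarith [hx.1]
  have dh : HasDerivAt (hh α β) (-(α / 2 + 1 / 4) / (1 - x) ^ 2 - (β / 2 + 1 / 4) / (1 + x) ^ 2) x := by
    have a1 := (hasDerivAt_const x (-(α / 2 + 1 / 4))).div ((hasDerivAt_id x).const_sub 1) h1.ne'
    have a2 := (hasDerivAt_const x (β / 2 + 1 / 4)).div ((hasDerivAt_id x).const_add 1) h2.ne'
    refine (a1.add a2).congr_deriv ?_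
    simp only [id]
    field_simp
    ring
  have dy := Q.hasDerivAt x
  have dy' := Q.derivative.hasDerivAt x
  have dz := dy'.add (dh.mul dy)
  have dx := ((hasDerivAt_id x).pow 2).const_sub 1
  have dE := (hasDerivAt_wt (α + 1 / 2) (β + 1 / 2) x hx).mul
    ((dx.mul (dz.pow 2)).add ((dy.pow 2).const_mul (L ^ 2)))
  refine dE.congr_deriv ?_
  have e1 : (1 - x) ^ (α + 1 / 2 - 1) = (1 - x) ^ (α + 1 / 2) / (1 - x) := Real.rpow_sub_one h1.ne' _
  have e2 : (1 + x) ^ (β + 1 / 2 - 1) = (1 + x) ^ (β + 1 / 2) / (1 + x) := Real.rpow_sub_one h2.ne' _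
  have ho := hQ x
  simp only [Pi.add_apply, Pi.mul_apply, Pi.pow_apply, id, e1, e2]
  set G1 := (1 - x) ^ (α + 1 / 2)
  set G2 := (1 + x) ^ (β + 1 / 2)
  set y := Q.eval x
  set y1 := Q.derivative.eval x
  set y2 := Q.derivative.derivative.eval x
  have key0 : G1 / (1 - x) * (G2 / (1 + x)) * (-(α + 1 / 2) * (1 + x) + (β + 1 / 2) * (1 - x)) =
      G1 * G2 * (2 * hh α β x) := by
    rw [hh]; field_simp; ring
  have key1 : 2 * (1 - x ^ 2) * hh α β x - x - (β - α - (α + β + 2) * x) = 0 := by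
    rw [hh]; field_simp; ring
  have key2 : (1 - x ^ 2) * (hh α β x ^ 2 +
      (-(α / 2 + 1 / 4) / (1 - x) ^ 2 - (β / 2 + 1 / 4) / (1 + x) ^ 2)) - x * hh α β x + qq α β x = 0 := by
    rw [hh, qq]; field_simp; ring
  rw [key0]
  set h := hh α β x
  set h' := (-(α / 2 + 1 / 4) / (1 - x) ^ 2 - (β / 2 + 1 / 4) / (1 + x) ^ 2)
  set q := qq α β x
  push_cast
  linear_combination G1 * G2 * 2 * (y1 + h * y) * (ho + y1 * key1 + y * key2)


lemma far (α β : ℝ) : ∃ K : ℝ, 0 ≤ K ∧ ∀ L : ℝ, 0 < L → ∀ Q, ODE α β (L ^ 2) Q →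
    ∀ x x0 : ℝ, 0 ≤ x → x ≤ x0 → x0 < 1 →
      En α β L Q x ≤ En α β L Q x0 * Real.exp (K / L * (1 - x0) ^ (-(1 / 2) : ℝ)) := by
  obtain ⟨Kq, hKq⟩ : ∃ K : ℝ, K = |1 / 4 - α ^ 2| + |1 / 4 - β ^ 2| + ((α + β + 1) / 2) ^ 2 := ⟨_, rfl⟩
  have hKq0 : 0 ≤ Kq := by rw [hKq]; positivity
  refine ⟨2 * Kq, by positivity, ?_⟩
  intro L hL Q hQ x x0 hx hxx hx0
  set κ := 2 * Kq / L with hκ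
  have hκ0 : 0 ≤ κ := by positivity
  have dd : ∀ t ∈ Icc x x0, HasDerivAt (fun t => En α β L Q t * Real.exp (κ * (1 - t) ^ (-(1 / 2) : ℝ)))
      ((-2 * qq α β t * ((1 - t) ^ (α + 1 / 2) * (1 + t) ^ (β + 1 / 2)) * Q.eval t *
        (Q.derivative.eval t + hh α β t * Q.eval t) + En α β L Q t * (κ * (1 / 2 * (1 - t) ^ (-(3 / 2) : ℝ))))
          * Real.exp (κ * (1 - t) ^ (-(1 / 2) : ℝ))) t := by
    intro t ht
    have h1 : 0 < 1 - t := by linarith [ht.2]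
    have d1 := ((((hasDerivAt_id t).const_sub 1).rpow_const (p := (-(1 / 2) : ℝ)) (Or.inl h1.ne')).const_mul κ).exp
    have d2 := (En_deriv α β L Q hQ t ⟨by linarith [ht.1], by linarith⟩).mul d1
    refine d2.congr_deriv ?_
    have : (-(1 / 2) - 1 : ℝ) = -(3 / 2) := by norm_num
    simp only [id, this]
    ring
  have mono : MonotoneOn (fun t => En α β L Q t * Real.exp (κ * (1 - t) ^ (-(1 / 2) : ℝ))) (Icc x x0) := by
    refine monotoneOn_of_hasDerivWithinAt_nonneg (convex_Icc x x0)
      (fun t ht => (dd t ht).continuousAt.continuousWithinAt)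
      (fun t ht => (dd t (interior_subset ht)).hasDerivWithinAt) ?_
    intro t ht
    have ht := interior_subset ht
    have h1 : 0 < 1 - t := by linarith [ht.2]
    have h2 : 1 ≤ 1 + t := by linarith [ht.1]
    have h3 : 1 - t ≤ 1 := by linarith [ht.1]
    refine mul_nonneg ?_ (Real.exp_pos _).le
    set G := (1 - t) ^ (α + 1 / 2) * (1 + t) ^ (β + 1 / 2) with hG
    have hGp : 0 < G := mul_pos (Real.rpow_pos_of_pos h1 _) (Real.rpow_pos_of_pos (by linarith) _)
    set z := Q.derivative.eval t + hh α β t * Q.eval t with hz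
    set y := Q.eval t with hy
    have hE : En α β L Q t = G * ((1 - t ^ 2) * z ^ 2 + L ^ 2 * y ^ 2) := rfl
    have hq : |qq α β t| ≤ Kq / (1 - t) := by
      rw [qq]
      have a1 : |(1 / 4 - α ^ 2) / (2 * (1 - t))| ≤ |1 / 4 - α ^ 2| / (1 - t) := by
        rw [abs_div, abs_of_pos (by positivity : 0 < 2 * (1 - t))]
        gcongr; linarith
      have a2 : |(1 / 4 - β ^ 2) / (2 * (1 + t))| ≤ |1 / 4 - β ^ 2| / (1 - t) := by
        rw [abs_div, abs_of_pos (by positivity : 0 < 2 * (1 + t))]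
        gcongr; linarith
      have a3 : |((α + β + 1) / 2) ^ 2| ≤ ((α + β + 1) / 2) ^ 2 / (1 - t) := by
        rw [abs_of_nonneg (by positivity), le_div_iff₀ h1]
        nlinarith [sq_nonneg ((α + β + 1) / 2)]
      calc _ ≤ _ := abs_add_three _ _ _
        _ ≤ _ := add_le_add (add_le_add a1 a2) a3
        _ = _ := by rw [hKq]; ring
    set r := (1 - t) ^ (-(1 / 2) : ℝ) with hr
    have hr0 : 0 < r := Real.rpow_pos_of_pos h1 _
    have hr2 : r ^ 2 * (1 - t) = 1 := by
      rw [hr, ← Real.rpow_natCast, ← Real.rpow_mul h1.le, ← Real.rpow_add_one h1.ne']; norm_num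
    have hr3 : (1 - t) ^ (-(3 / 2) : ℝ) = r / (1 - t) := by
      rw [hr, ← Real.rpow_sub_one h1.ne']; norm_num

    have hyz : 2 * |y * z| ≤ r / L * ((1 - t ^ 2) * z ^ 2 + L ^ 2 * y ^ 2) := by
      have e : r / L * ((1 - t ^ 2) * z ^ 2 + L ^ 2 * y ^ 2) =
        ((r ^ 2 * (1 - t)) * (1 + t) * z ^ 2 + r ^ 2 * L ^ 2 * y ^ 2) / (r * L) := by
        field_simp; ring
      rw [e, hr2, le_div_iff₀ (by positivity), abs_mul, ← sq_abs z, ← sq_abs y]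
      nlinarith [sq_nonneg (|z| - r * L * |y|), sq_nonneg |z|]
    rw [hE, hr3]
    have h5 : |-2 * qq α β t * G * y * z| ≤ Kq / (1 - t) * G * (r / L * ((1 - t ^ 2) * z ^ 2 + L ^ 2 * y ^ 2)) := by
      calc |-2 * qq α β t * G * y * z| = |qq α β t| * G * (2 * |y * z|) := by
            simp only [abs_mul, abs_neg, abs_of_pos hGp, abs_two]; ring
        _ ≤ _ := by gcongr
    have h6 := (abs_le.1 h5).1
    have e : G * ((1 - t ^ 2) * z ^ 2 + L ^ 2 * y ^ 2) * (κ * (1 / 2 * (r / (1 - t)))) =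
      Kq / (1 - t) * G * (r / L * ((1 - t ^ 2) * z ^ 2 + L ^ 2 * y ^ 2)) := by
      rw [hκ]; field_simp
    linarith
  have hm := mono (left_mem_Icc.2 hxx) (right_mem_Icc.2 hxx) hxx
  simp only at hm
  refine le_trans ?_ hm
  have hE0 : 0 ≤ En α β L Q x := by
    rw [En]
    have h1 : 0 < 1 - x := by linarith
    have : 0 ≤ 1 - x ^ 2 := by nlinarith
    positivity
  have : 1 ≤ Real.exp (κ * (1 - x) ^ (-(1 / 2) : ℝ)) := by
    apply Real.one_le_exp
    have := Real.rpow_nonneg (by linarith : 0 ≤ 1 - x) (-(1 / 2) : ℝ)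
    positivity
  nlinarith

lemma hh_bound (α β x : ℝ) (hx : 0 ≤ x) (hx1 : x < 1) :
    |hh α β x| ≤ (|α / 2 + 1 / 4| + |β / 2 + 1 / 4|) / (1 - x) := by
  have h1 : 0 < 1 - x := by linarith
  rw [hh, add_div |α / 2 + 1 / 4|]
  refine (abs_add_le _ _).trans (add_le_add ?_ ?_)
  · rw [abs_div, abs_neg, abs_of_pos h1]
  · rw [abs_div, abs_of_pos (by linarith : 0 < 1 + x)]
    gcongr; linarith

set_option maxHeartbeats 1000000 in
lemma est (α β : ℝ) (hα : -1 < α) (hβ : -1 < β) : ∃ c C : ℝ, 0 < c ∧ c < 1 ∧ 0 < C ∧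
    ∀ n l : ℝ, 1 ≤ n → n ^ 2 / 2 ≤ l → l ≤ 2 * n ^ 2 → ∀ Q, ODE α β l Q →
      |Q.eval 1| ≤ Real.exp |α| * n ^ α →
      (∀ x ∈ Icc (1 - c / n ^ 2) 1, |Q.eval x| ≤ C * n ^ α) ∧
      (∀ x ∈ Icc 0 (1 - c / n ^ 2),
        |Q.eval x| ≤ C * n ^ (-(1 / 2) : ℝ) * (1 - x) ^ (-α / 2 - 1 / 4) ∧
        |Q.derivative.eval x| ≤ C * n ^ (1 / 2 : ℝ) * (1 - x) ^ (-α / 2 - 3 / 4)) := by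
  obtain ⟨c, K, hc0, hc1, hK0, hnear⟩ := near α β hα hβ
  obtain ⟨κ, hκ0, hfar⟩ := far α β
  obtain ⟨H, hH⟩ : ∃ H : ℝ, H = |α / 2 + 1 / 4| + |β / 2 + 1 / 4| := ⟨_, rfl⟩
  have hH0 : 0 ≤ H := by rw [hH]; positivity
  obtain ⟨B, hB⟩ : ∃ B : ℝ, B = 2 ^ |β + 1 / 2| := ⟨_, rfl⟩
  have hB0 : 0 < B := by rw [hB]; positivity
  obtain ⟨A, hA⟩ : ∃ A : ℝ, A = Real.exp |α| := ⟨_, rfl⟩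
  have hA0 : 0 < A := by rw [hA]; positivity
  obtain ⟨C1, hC1⟩ : ∃ C1 : ℝ, C1 = c ^ (α + 1 / 2) * B * (A ^ 2 * (2 * c * (K + 2 * H / c) ^ 2 + 8)) := ⟨_, rfl⟩
  have hC10 : 0 < C1 := by rw [hC1]; positivity
  obtain ⟨C2, hC2⟩ : ∃ C2 : ℝ, C2 = C1 * Real.exp (2 * κ * c ^ (-(1 / 2) : ℝ)) := ⟨_, rfl⟩
  have hC20 : 0 < C2 := by rw [hC2]; positivity
  obtain ⟨D, hD⟩ : ∃ D : ℝ, D = Real.sqrt (2 * C2 * B) := ⟨_, rfl⟩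
  have hD0 : 0 < D := by rw [hD]; positivity
  have hD2 : D ^ 2 = 2 * C2 * B := by rw [hD]; exact Real.sq_sqrt (by positivity)
  refine ⟨c, 2 * A + D + H * D * c ^ (-(1 / 2) : ℝ), hc0, hc1, by positivity, ?_⟩
  intro n l hn hl1 hl2 Q hQ hQ1
  rw [← hA] at hQ1
  have hn0 : 0 < n := by linarith
  have hn2 : 1 ≤ n ^ 2 := by nlinarith
  have hl0 : 0 < l := by nlinarith
  obtain ⟨hy0, hy0'⟩ := hnear n l hn hl0 hl2 Q hQ
  have hcn : c / n ^ 2 < 1 := by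
    rw [div_lt_iff₀ (by positivity)]; nlinarith
  have hcn0 : 0 < c / n ^ 2 := by positivity
  set x0 := 1 - c / n ^ 2 with hx0
  have hcx : 1 - x0 = c / n ^ 2 := by rw [hx0]; ring
  have hx0p : 0 < x0 := by linarith
  have hx01 : x0 < 1 := by linarith
  set Y := A * n ^ α with hY
  have hnα : 0 < n ^ α := Real.rpow_pos_of_pos hn0 _
  have hY0 : 0 < Y := by positivity
  have hc12 : 0 < c ^ (-(1 / 2) : ℝ) := Real.rpow_pos_of_pos hc0 _
  constructor
  · intro x hx
    refine (hy0 x hx).trans ?_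
    calc 2 * |Q.eval 1| ≤ 2 * (A * n ^ α) := by gcongr
      _ = 2 * A * n ^ α := by ring
      _ ≤ _ := by
        gcongr
        have : 0 ≤ H * D * c ^ (-(1 / 2) : ℝ) := by positivity
        linarith
  obtain ⟨L, hL0, hL2⟩ : ∃ L : ℝ, 0 < L ∧ L ^ 2 = l := ⟨Real.sqrt l, by positivity, Real.sq_sqrt hl0.le⟩
  have hLn : n / 2 ≤ L := by
    by_contra h
    push Not at h
    nlinarith
  rw [← hL2] at hQ
  have hE0 : En α β L Q x0 ≤ C1 * n := by
    have b1 : |Q.eval x0| ≤ 2 * Y := (hy0 x0 ⟨le_rfl, hx01.le⟩).trans (by linarith)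
    have b2 : |Q.derivative.eval x0| ≤ K * n ^ 2 * Y := (hy0' x0 ⟨le_rfl, hx01⟩).trans (by gcongr)
    have b3 : |hh α β x0| ≤ H / c * n ^ 2 := by
      refine (hh_bound α β x0 hx0p.le hx01).trans (le_of_eq ?_)
      rw [hcx, ← hH]; field_simp
    have b4 : |Q.derivative.eval x0 + hh α β x0 * Q.eval x0| ≤ (K + 2 * H / c) * n ^ 2 * Y := by
      calc _ ≤ _ := abs_add_le _ _
        _ = |Q.derivative.eval x0| + |hh α β x0| * |Q.eval x0| := by rw [abs_mul]
        _ ≤ K * n ^ 2 * Y + H / c * n ^ 2 * (2 * Y) := by gcongr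
        _ = _ := by ring
    have b5 : (1 + x0) ^ (β + 1 / 2) ≤ B := by rw [hB]; exact one_add_rpow_le _ _ hx0p.le hx01.le
    have b6 : 1 - x0 ^ 2 ≤ 2 * (c / n ^ 2) := by rw [← hcx]; nlinarith only [sq_nonneg (1 - x0)]
    have b6' : 0 ≤ 1 - x0 ^ 2 := by nlinarith only [hx0p, hx01]
    have b7 : (1 - x0) ^ (α + 1 / 2) * n ^ 2 * (n ^ α) ^ 2 = c ^ (α + 1 / 2) * n := by
      rw [hcx, Real.div_rpow hc0.le (by positivity), ← Real.rpow_natCast n 2, ← Real.rpow_natCast (n ^ α) 2, ← Real.rpow_mul hn0.le,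
        ← Real.rpow_mul hn0.le, div_eq_mul_inv, ← Real.rpow_neg hn0.le, mul_assoc, mul_assoc, ← Real.rpow_add hn0, ← Real.rpow_add hn0]
      congr 1
      rw [show (-(((2:ℕ):ℝ) * (α + 1 / 2)) + (((2:ℕ):ℝ) + α * ((2:ℕ):ℝ)) : ℝ) = 1 by push_cast; ring, Real.rpow_one]
    have hG1 : 0 < (1 - x0) ^ (α + 1 / 2) := Real.rpow_pos_of_pos (by linarith) _
    rw [En]
    calc (1 - x0) ^ (α + 1 / 2) * (1 + x0) ^ (β + 1 / 2) *
        ((1 - x0 ^ 2) * (Q.derivative.eval x0 + hh α β x0 * Q.eval x0) ^ 2 + L ^ 2 * Q.eval x0 ^ 2)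
        ≤ (1 - x0) ^ (α + 1 / 2) * B *
          (2 * (c / n ^ 2) * ((K + 2 * H / c) * n ^ 2 * Y) ^ 2 + 2 * n ^ 2 * (2 * Y) ^ 2) := by
          rw [← sq_abs (Q.derivative.eval x0 + hh α β x0 * Q.eval x0), ← sq_abs (Q.eval x0), hL2]
          gcongr
      _ = ((1 - x0) ^ (α + 1 / 2) * n ^ 2 * (n ^ α) ^ 2) * B * (A ^ 2 * (2 * c * (K + 2 * H / c) ^ 2 + 8)) := by
          rw [hY]; field_simp; ring
      _ = C1 * n := by rw [b7, hC1]; ring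
  intro x hx
  have hx1 : x < 1 := lt_of_le_of_lt hx.2 hx01
  have h1x : 0 < 1 - x := by linarith
  have hEx : En α β L Q x ≤ C2 * n := by
    refine (hfar L hL0 Q hQ x x0 hx.1 hx.2 hx01).trans ?_
    have : κ / L * (1 - x0) ^ (-(1 / 2) : ℝ) ≤ 2 * κ * c ^ (-(1 / 2) : ℝ) := by
      rw [hcx, Real.div_rpow hc0.le (by positivity)]
      have : (n ^ 2) ^ (-(1 / 2) : ℝ) = n⁻¹ := by
        rw [← Real.rpow_natCast, ← Real.rpow_mul hn0.le]; norm_num [Real.rpow_neg_one]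
      rw [this, div_inv_eq_mul]
      calc κ / L * (c ^ (-(1 / 2) : ℝ) * n) ≤ κ / (n / 2) * (c ^ (-(1 / 2) : ℝ) * n) := by gcongr
        _ = _ := by field_simp
    calc _ ≤ C1 * n * Real.exp (2 * κ * c ^ (-(1 / 2) : ℝ)) := by gcongr
      _ = _ := by rw [hC2]; ring
  rw [En] at hEx
  set z := Q.derivative.eval x + hh α β x * Q.eval x with hz
  set g := (1 - x) ^ (α / 2 + 1 / 4) with hg
  have hg0 : 0 < g := Real.rpow_pos_of_pos h1x _
  have hg2 : (1 - x) ^ (α + 1 / 2) = g ^ 2 := by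
    rw [hg, ← Real.rpow_natCast, ← Real.rpow_mul h1x.le]; congr 1; push_cast; ring
  have hBx : 1 ≤ B * (1 + x) ^ (β + 1 / 2) := by rw [hB]; exact one_le_add_rpow _ _ hx.1 hx1.le
  have hEx' : g ^ 2 * ((1 - x) * z ^ 2 + n ^ 2 / 2 * Q.eval x ^ 2) ≤ C2 * B * n := by
    have h0 : 0 ≤ (1 - x) * z ^ 2 + n ^ 2 / 2 * Q.eval x ^ 2 := by positivity
    have hgB : g ^ 2 ≤ g ^ 2 * (B * (1 + x) ^ (β + 1 / 2)) := le_mul_of_one_le_right (by positivity) hBx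
    have hgB0 : 0 ≤ g ^ 2 * (B * (1 + x) ^ (β + 1 / 2)) := (sq_nonneg g).trans hgB
    calc g ^ 2 * ((1 - x) * z ^ 2 + n ^ 2 / 2 * Q.eval x ^ 2)
        ≤ g ^ 2 * (B * (1 + x) ^ (β + 1 / 2)) * ((1 - x) * z ^ 2 + n ^ 2 / 2 * Q.eval x ^ 2) :=
          mul_le_mul_of_nonneg_right hgB h0
      _ ≤ g ^ 2 * (B * (1 + x) ^ (β + 1 / 2)) * ((1 - x ^ 2) * z ^ 2 + L ^ 2 * Q.eval x ^ 2) := by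
        rw [hL2]
        gcongr
        have := hx.1
        nlinarith only [h1x, this]
      _ = B * ((1 - x) ^ (α + 1 / 2) * (1 + x) ^ (β + 1 / 2) * ((1 - x ^ 2) * z ^ 2 + L ^ 2 * Q.eval x ^ 2)) := by
        rw [hg2]; ring
      _ ≤ B * (C2 * n) := by gcongr
      _ = _ := by ring
  set v := n ^ (1 / 2 : ℝ) with hv
  have hv0 : 0 < v := Real.rpow_pos_of_pos hn0 _
  have hv2 : v ^ 2 = n := by
    rw [hv, ← Real.rpow_natCast, ← Real.rpow_mul hn0.le]; norm_num
  set w := (1 - x) ^ (1 / 2 : ℝ) with hw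
  have hw0 : 0 < w := Real.rpow_pos_of_pos h1x _
  have hw2 : w ^ 2 = 1 - x := by
    rw [hw, ← Real.rpow_natCast, ← Real.rpow_mul h1x.le]; norm_num
  have e1 : n ^ (-(1 / 2) : ℝ) = v⁻¹ := Real.rpow_neg hn0.le _
  have e2 : (1 - x) ^ (-α / 2 - 1 / 4) = g⁻¹ := by
    rw [hg, ← Real.rpow_neg h1x.le]; congr 1; ring
  have e3 : (1 - x) ^ (-α / 2 - 3 / 4) = g⁻¹ * w⁻¹ := by
    rw [hg, hw, ← Real.rpow_neg h1x.le, ← Real.rpow_neg h1x.le, ← Real.rpow_add h1x]; congr 1; ring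
  have hY1 : |Q.eval x| ≤ D * v⁻¹ * g⁻¹ := by
    apply abs_le_of_sq_le_sq _ (by positivity)
    have h3 : g ^ 2 * (n ^ 2 / 2 * Q.eval x ^ 2) ≤ C2 * B * n := by
      have : 0 ≤ g ^ 2 * ((1 - x) * z ^ 2) := by positivity
      linarith
    have e : (D * v⁻¹ * g⁻¹) ^ 2 = 2 * C2 * B * n / (g ^ 2 * n ^ 2) := by
      rw [mul_pow, mul_pow, hD2, inv_pow, inv_pow, hv2]; field_simp
    rw [e, le_div_iff₀ (by positivity)]
    linarith
  have hZ1 : |z| ≤ D * v * g⁻¹ * w⁻¹ := by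
    apply abs_le_of_sq_le_sq _ (by positivity)
    have h3 : g ^ 2 * ((1 - x) * z ^ 2) ≤ C2 * B * n := by
      have : 0 ≤ g ^ 2 * (n ^ 2 / 2 * Q.eval x ^ 2) := by positivity
      linarith
    have e : (D * v * g⁻¹ * w⁻¹) ^ 2 = 2 * C2 * B * n / (g ^ 2 * (1 - x)) := by
      rw [mul_pow, mul_pow, mul_pow, hD2, inv_pow, inv_pow, hv2, hw2]; field_simp
    rw [e, le_div_iff₀ (by positivity)]
    have : 0 ≤ C2 * B * n := by positivity
    linarith
  have hwn : w⁻¹ ≤ c ^ (-(1 / 2) : ℝ) * n := by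
    have hd : c / n ^ 2 ≤ 1 - x := by linarith [hx.2]
    have : (c / n ^ 2) ^ (1 / 2 : ℝ) ≤ w := Real.rpow_le_rpow hcn0.le hd (by norm_num)
    have h4 : ((c / n ^ 2) ^ (1 / 2 : ℝ)) = (c ^ (-(1 / 2) : ℝ) * n)⁻¹ := by
      rw [Real.div_rpow hc0.le (by positivity), Real.rpow_neg hc0.le, ← Real.rpow_natCast n 2, ← Real.rpow_mul hn0.le]
      norm_num
      field_simp
    rw [h4] at this
    exact inv_le_of_inv_le₀ (by positivity) this
  have hQ' : |Q.derivative.eval x| ≤ (D + H * D * c ^ (-(1 / 2) : ℝ)) * v * (g⁻¹ * w⁻¹) := by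
    have e : Q.derivative.eval x = z - hh α β x * Q.eval x := by rw [hz]; ring
    have hb := hh_bound α β x hx.1 hx1
    rw [← hH, ← hw2] at hb
    calc |Q.derivative.eval x| ≤ |z| + |hh α β x| * |Q.eval x| := by
          rw [e, ← abs_mul]; exact abs_sub _ _
      _ ≤ D * v * g⁻¹ * w⁻¹ + H / w ^ 2 * (D * v⁻¹ * g⁻¹) := by gcongr
      _ = D * v * g⁻¹ * w⁻¹ + H * D * v⁻¹ * g⁻¹ * w⁻¹ * w⁻¹ := by field_simp
      _ ≤ D * v * g⁻¹ * w⁻¹ + H * D * v⁻¹ * g⁻¹ * w⁻¹ * (c ^ (-(1 / 2) : ℝ) * n) := by gcongr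
      _ = _ := by rw [← hv2]; field_simp
  rw [e1, e2, e3]
  constructor
  · refine hY1.trans ?_
    gcongr
    have : 0 ≤ H * D * c ^ (-(1 / 2) : ℝ) := by positivity
    linarith
  · refine hQ'.trans ?_
    gcongr
    linarith


noncomputable def kk (γ δ : ℝ) (Q : Polynomial ℝ) (t : ℝ) : ℝ := (1 - t) ^ δ * (1 + t) ^ γ * Q.eval t

lemma kk_int (γ δ : ℝ) (hδ : -1 < δ) (Q : Polynomial ℝ) : IntervalIntegrable (kk γ δ Q) volume 0 1 := by
  have h1 : IntervalIntegrable (fun t : ℝ => (1 - t) ^ δ) volume 0 1 := by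
    have := (intervalIntegral.intervalIntegrable_rpow' (a := 1) (b := 0) hδ).comp_sub_left 1
    simpa using this
  have h2 : ContinuousOn (fun t : ℝ => (1 + t) ^ γ * Q.eval t) (uIcc 0 1) := by
    rw [uIcc_of_le zero_le_one]
    refine ContinuousOn.mul ?_ Q.continuous.continuousOn
    exact (continuousOn_const.add continuousOn_id).rpow_const
      (fun t ht => Or.inl (by have := ht.1; exact (by linarith : (0 : ℝ) < 1 + t).ne'))
  have := h1.mul_continuousOn h2
  refine this.congr ?_
  intro t _
  simp only [kk]; ring

noncomputable def FF (γ δ : ℝ) (Q : Polynomial ℝ) (x : ℝ) : ℝ := ∫ t in (0 : ℝ)..x, kk γ δ Q t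

lemma FF_cont (γ δ : ℝ) (hδ : -1 < δ) (Q : Polynomial ℝ) : ContinuousOn (FF γ δ Q) (Icc 0 1) := by
  have h := kk_int γ δ hδ Q
  have := intervalIntegral.continuousOn_primitive_interval' h (a := 0) (by simp)
  rwa [uIcc_of_le zero_le_one] at this

lemma FF_deriv (γ δ : ℝ) (hδ : -1 < δ) (Q : Polynomial ℝ) (x : ℝ) (hx : x ∈ Ico (0 : ℝ) 1) :
    HasDerivAt (FF γ δ Q) (kk γ δ Q x) x := by
  have hc : ContinuousOn (kk γ δ Q) (Ioo (-1) 1) := fun t ht =>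
    ((hasDerivAt_wt δ γ t ht).mul (Q.hasDerivAt t)).continuousAt.continuousWithinAt
  have hx' : x ∈ Ioo (-1 : ℝ) 1 := ⟨by linarith [hx.1], hx.2⟩
  refine intervalIntegral.integral_hasDerivAt_right ?_ (hc.stronglyMeasurableAtFilter isOpen_Ioo x hx')
    (hc.continuousAt (isOpen_Ioo.mem_nhds hx'))
  refine (kk_int γ δ hδ Q).mono_set ?_
  rw [uIcc_of_le hx.1, uIcc_of_le zero_le_one]
  exact Icc_subset_Icc le_rfl hx.2.le

lemma AA_deriv (α β γ δ l : ℝ) (Q : Polynomial ℝ) (hQ : ODE α β l Q) (x : ℝ) (hx : x ∈ Ico (0 : ℝ) 1) :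
    HasDerivAt (fun t => (1 - t) ^ (δ + 1) * (1 + t) ^ (γ + 1) * Q.derivative.eval t)
      ((1 - x) ^ δ * (1 + x) ^ γ * ((α - δ) * (1 + x) + (γ - β) * (1 - x)) * Q.derivative.eval x
        - l * kk γ δ Q x) x := by
  have hx' : x ∈ Ioo (-1 : ℝ) 1 := ⟨by linarith [hx.1], hx.2⟩
  have := (hasDerivAt_wt (δ + 1) (γ + 1) x hx').mul (Q.derivative.hasDerivAt x)
  refine this.congr_deriv ?_
  have h1 : 0 < 1 - x := by linarith [hx'.2]
  have h2 : 0 < 1 + x := by linarith [hx'.1]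
  rw [add_sub_cancel_right, add_sub_cancel_right, Real.rpow_add_one h1.ne', Real.rpow_add_one h2.ne', kk]
  linear_combination ((1 - x) ^ δ * (1 + x) ^ γ) * hQ x

lemma BB_deriv (α β γ δ : ℝ) (Q : Polynomial ℝ) (x : ℝ) (hx : x ∈ Ico (0 : ℝ) 1) :
    HasDerivAt (fun t => (1 - t) ^ δ * (1 + t) ^ γ * ((α - δ) * (1 + t) + (γ - β) * (1 - t)) * Q.eval t)
      ((1 - x) ^ δ * (1 + x) ^ γ * ((α - δ) * (1 + x) + (γ - β) * (1 - x)) * Q.derivative.eval x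
        + (1 - x) ^ (δ - 1) * (1 + x) ^ (γ - 1) * ((-δ * (1 + x) + γ * (1 - x)) *
          ((α - δ) * (1 + x) + (γ - β) * (1 - x)) + (1 - x) * (1 + x) * (α - δ - (γ - β))) * Q.eval x) x := by
  have hx' : x ∈ Ioo (-1 : ℝ) 1 := ⟨by linarith [hx.1], hx.2⟩
  have h1 : 0 < 1 - x := by linarith [hx'.2]
  have h2 : 0 < 1 + x := by linarith [hx'.1]
  have d1 := (((hasDerivAt_id x).const_add 1).const_mul (α - δ)).add
    (((hasDerivAt_id x).const_sub 1).const_mul (γ - β))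
  have := ((hasDerivAt_wt δ γ x hx').mul d1).mul (Q.hasDerivAt x)
  refine this.congr_deriv ?_
  have e1 : (1 - x) ^ δ = (1 - x) ^ (δ - 1) * (1 - x) := by
    rw [← Real.rpow_add_one h1.ne']; simp
  have e2 : (1 + x) ^ γ = (1 + x) ^ (γ - 1) * (1 + x) := by
    rw [← Real.rpow_add_one h2.ne']; simp
  simp only [e1, e2, id, Pi.add_apply, Pi.mul_apply]
  ring

lemma lin_bound (a b x : ℝ) (h0 : 0 ≤ x) (h1 : x ≤ 1) :
    |a * (1 + x) + b * (1 - x)| ≤ 2 * (|a| + |b|) := by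
  refine (abs_add_le _ _).trans ?_
  rw [abs_mul, abs_mul, abs_of_nonneg (by linarith : 0 ≤ 1 + x), abs_of_nonneg (by linarith : 0 ≤ 1 - x)]
  nlinarith [abs_nonneg a, abs_nonneg b]

lemma AA_bound (α γ δ C v : ℝ) (hC : 0 ≤ C) (hv : 0 ≤ v) (Q : Polynomial ℝ) (x : ℝ) (hx : x ∈ Ico (0 : ℝ) 1)
    (hb : |Q.derivative.eval x| ≤ C * v * (1 - x) ^ (-α / 2 - 3 / 4)) :
    |(1 - x) ^ (δ + 1) * (1 + x) ^ (γ + 1) * Q.derivative.eval x| ≤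
      2 ^ |γ + 1| * C * v * (1 - x) ^ (δ - α / 2 + 1 / 4) := by
  have h1 : 0 < 1 - x := by linarith [hx.2]
  have h2 : 0 < 1 + x := by linarith [hx.1]
  have p1 := Real.rpow_pos_of_pos h1 (δ + 1)
  have p2 := Real.rpow_pos_of_pos h2 (γ + 1)
  have b2 := one_add_rpow_le (γ + 1) x hx.1 hx.2.le
  rw [abs_mul, abs_mul, abs_of_pos p1, abs_of_pos p2]
  calc (1 - x) ^ (δ + 1) * (1 + x) ^ (γ + 1) * |Q.derivative.eval x| ≤
      (1 - x) ^ (δ + 1) * 2 ^ |γ + 1| * (C * v * (1 - x) ^ (-α / 2 - 3 / 4)) := by gcongr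
    _ = 2 ^ |γ + 1| * C * v * ((1 - x) ^ (δ + 1) * (1 - x) ^ (-α / 2 - 3 / 4)) := by ring
    _ = _ := by rw [← Real.rpow_add h1]; congr 2; ring

lemma farInt_pos (α β γ δ C : ℝ) (hδ : -1 < δ) (hC : 0 < C) (hε : 0 < δ - α / 2 + 1 / 4) :
    ∃ K : ℝ, 0 < K ∧ ∀ n l x0 : ℝ, 1 ≤ n → n ^ 2 / 2 ≤ l → x0 < 1 → ∀ Q, ODE α β l Q →
      (∀ x ∈ Icc 0 x0, |Q.derivative.eval x| ≤ C * n ^ (1 / 2 : ℝ) * (1 - x) ^ (-α / 2 - 3 / 4)) →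
      ∀ x ∈ Icc 0 x0, |FF γ δ Q x| ≤ K * n ^ (-(3 / 2) : ℝ) := by
  obtain ⟨e, he⟩ : ∃ e : ℝ, e = δ - α / 2 + 1 / 4 := ⟨_, rfl⟩
  rw [← he] at hε
  obtain ⟨K1, hK1⟩ : ∃ K : ℝ, K = 2 ^ |γ + 1| * C := ⟨_, rfl⟩
  have hK10 : 0 < K1 := by rw [hK1]; positivity
  obtain ⟨K2, hK2⟩ : ∃ K : ℝ, K = 2 ^ |γ| * (2 * (|α - δ| + |γ - β|)) * C := ⟨_, rfl⟩
  have hK20 : 0 ≤ K2 := by rw [hK2]; positivity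
  refine ⟨2 * (2 * K1 + K2 / e), by positivity, ?_⟩
  intro n l x0 hn hl hx0 Q hQ hb x hx
  have hn0 : 0 < n := by linarith
  have hl0 : 0 < l := by nlinarith
  set v := n ^ (1 / 2 : ℝ) with hv
  have hv0 : 0 < v := Real.rpow_pos_of_pos hn0 _
  have hIco : ∀ t ∈ Icc 0 x, t ∈ Ico (0 : ℝ) 1 := fun t ht => ⟨ht.1, by linarith [ht.2, hx.2]⟩
  have hA : ∀ t ∈ Icc 0 x, |(1 - t) ^ (δ + 1) * (1 + t) ^ (γ + 1) * Q.derivative.eval t| ≤ K1 * v := by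
    intro t ht
    refine (AA_bound α γ δ C v hC.le hv0.le Q t (hIco t ht) (hb t ⟨ht.1, ht.2.trans hx.2⟩)).trans ?_
    rw [← he, ← hK1]
    have : (1 - t) ^ e ≤ 1 := Real.rpow_le_one (by linarith [(hIco t ht).2]) (by linarith [ht.1]) hε.le
    exact mul_le_of_le_one_right (by positivity) this
  have dΦ : ∀ t ∈ Icc 0 x, HasDerivAt
      (fun t => l * FF γ δ Q t + (1 - t) ^ (δ + 1) * (1 + t) ^ (γ + 1) * Q.derivative.eval t)
      ((1 - t) ^ δ * (1 + t) ^ γ * ((α - δ) * (1 + t) + (γ - β) * (1 - t)) * Q.derivative.eval t) t := by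
    intro t ht
    refine (((FF_deriv γ δ hδ Q t (hIco t ht)).const_mul l).add
      (AA_deriv α β γ δ l Q hQ t (hIco t ht))).congr_deriv ?_
    ring
  have dΨ : ∀ t ∈ Icc 0 x, HasDerivAt (fun t => -(K2 * v / e) * (1 - t) ^ e) (K2 * v * (1 - t) ^ (e - 1)) t := by
    intro t ht
    have h1 : 0 < 1 - t := by linarith [(hIco t ht).2]
    refine ((((hasDerivAt_id t).const_sub 1).rpow_const (p := e) (Or.inl h1.ne')).const_mul _).congr_deriv ?_
    simp only [id]
    field_simp
  have hc := compare _ _ _ _ 0 x hx.1 (fun t ht => (dΦ t ht).continuousAt.continuousWithinAt)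
    (fun t ht => (dΨ t ht).continuousAt.continuousWithinAt) (fun t ht => dΦ t (Ioo_subset_Icc_self ht))
    (fun t ht => dΨ t (Ioo_subset_Icc_self ht)) ?_
  · have hF0 : FF γ δ Q 0 = 0 := by simp [FF]
    simp only [hF0] at hc
    have a1 := hA 0 ⟨le_rfl, hx.1⟩
    have a2 := hA x ⟨hx.1, le_rfl⟩
    set A0 := (1 - (0:ℝ)) ^ (δ + 1) * (1 + 0) ^ (γ + 1) * Q.derivative.eval 0
    set Ax := (1 - x) ^ (δ + 1) * (1 + x) ^ (γ + 1) * Q.derivative.eval x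
    have hp : 0 ≤ K2 * v / e * (1 - x) ^ e := by
      have := Real.rpow_nonneg (by linarith [hx.2] : 0 ≤ 1 - x) e
      positivity
    have hlF : |l * FF γ δ Q x| ≤ (2 * K1 + K2 / e) * v := by
      rw [sub_zero, Real.one_rpow] at hc
      have e1 : l * FF γ δ Q x = (l * FF γ δ Q x + Ax - (l * 0 + A0)) + A0 - Ax := by ring
      rw [e1]
      have := abs_sub (l * FF γ δ Q x + Ax - (l * 0 + A0) + A0) Ax
      have := abs_add_le (l * FF γ δ Q x + Ax - (l * 0 + A0)) A0
      have e2 : (2 * K1 + K2 / e) * v = K1 * v + K1 * v + K2 * v / e := by ring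
      rw [e2]
      linarith
    rw [abs_mul, abs_of_pos hl0] at hlF
    have e3 : v = n ^ 2 * n ^ (-(3 / 2) : ℝ) := by
      rw [← Real.rpow_natCast, ← Real.rpow_add hn0, hv]; norm_num
    have h3 : n ^ 2 / 2 * |FF γ δ Q x| ≤ (2 * K1 + K2 / e) * (n ^ 2 * n ^ (-(3 / 2) : ℝ)) := by
      rw [← e3]
      exact (mul_le_mul_of_nonneg_right hl (abs_nonneg _)).trans hlF
    have h4 : n ^ 2 * |FF γ δ Q x| ≤ n ^ 2 * (2 * (2 * K1 + K2 / e) * n ^ (-(3 / 2) : ℝ)) := by linarith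
    exact le_of_mul_le_mul_left h4 (by positivity)
  · intro t ht
    have ht := Ioo_subset_Icc_self ht
    have h1 : 0 < 1 - t := by linarith [(hIco t ht).2]
    have h2 : 0 < 1 + t := by linarith [(hIco t ht).1]
    have p1 := Real.rpow_pos_of_pos h1 δ
    have p2 := Real.rpow_pos_of_pos h2 γ
    have b2 := one_add_rpow_le γ t ht.1 (hIco t ht).2.le
    have b3 := lin_bound (α - δ) (γ - β) t ht.1 (hIco t ht).2.le
    have b4 := hb t ⟨ht.1, ht.2.trans hx.2⟩
    rw [abs_mul, abs_mul, abs_mul, abs_of_pos p1, abs_of_pos p2]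
    calc (1 - t) ^ δ * (1 + t) ^ γ * |(α - δ) * (1 + t) + (γ - β) * (1 - t)| * |Q.derivative.eval t|
        ≤ (1 - t) ^ δ * 2 ^ |γ| * (2 * (|α - δ| + |γ - β|)) * (C * v * (1 - t) ^ (-α / 2 - 3 / 4)) := by
          gcongr
      _ = K2 * v * ((1 - t) ^ δ * (1 - t) ^ (-α / 2 - 3 / 4)) := by rw [hK2]; ring
      _ = _ := by rw [← Real.rpow_add h1, he]; congr 2; ring

lemma farInt_neg (α β γ δ C c : ℝ) (hδ : -1 < δ) (hC : 0 < C) (hc0 : 0 < c) (hε : δ - α / 2 + 1 / 4 ≤ 0) :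
    ∃ K : ℝ, 0 < K ∧ ∀ n l : ℝ, 1 ≤ n → n ^ 2 / 2 ≤ l → ∀ Q, ODE α β l Q →
      (∀ x ∈ Icc 0 (1 - c / n ^ 2),
        |Q.eval x| ≤ C * n ^ (-(1 / 2) : ℝ) * (1 - x) ^ (-α / 2 - 1 / 4) ∧
        |Q.derivative.eval x| ≤ C * n ^ (1 / 2 : ℝ) * (1 - x) ^ (-α / 2 - 3 / 4)) →
      ∀ x ∈ Icc 0 (1 - c / n ^ 2), |FF γ δ Q x| ≤ K * n ^ (-(2 * δ - α + 2)) := by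
  obtain ⟨e, he⟩ : ∃ e : ℝ, e = δ - α / 2 + 1 / 4 := ⟨_, rfl⟩
  rw [← he] at hε
  obtain ⟨K1, hK1⟩ : ∃ K : ℝ, K = 2 ^ |γ + 1| * C := ⟨_, rfl⟩
  have hK10 : 0 < K1 := by rw [hK1]; positivity
  obtain ⟨K2, hK2⟩ : ∃ K : ℝ, K = 2 ^ |γ| * (2 * (|α - δ| + |γ - β|)) * C := ⟨_, rfl⟩
  have hK20 : 0 ≤ K2 := by rw [hK2]; positivity
  obtain ⟨K3, hK3⟩ : ∃ K : ℝ, K = 2 ^ |γ - 1| * ((2 * (|δ| + |γ|)) * (2 * (|α - δ| + |γ - β|)) + |α - δ - (γ - β)|) * C := ⟨_, rfl⟩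
  have hK30 : 0 ≤ K3 := by rw [hK3]; positivity
  obtain ⟨f, hf⟩ : ∃ f : ℝ, f = 1 / 2 - e := ⟨_, rfl⟩
  have hf0 : 0 < f := by linarith
  have hce : 0 < c ^ e := Real.rpow_pos_of_pos hc0 _
  have hcf : 0 < c ^ (-f) := Real.rpow_pos_of_pos hc0 _
  refine ⟨2 * (2 * (K1 * c ^ e) + 2 * (K2 * c ^ (-f)) + K3 / f * c ^ (-f)), by positivity, ?_⟩
  intro n l hn hl Q hQ hb x hx
  have hn0 : 0 < n := by linarith
  have hl0 : 0 < l := by nlinarith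
  have hcn0 : 0 < c / n ^ 2 := by positivity
  set v := n ^ (1 / 2 : ℝ) with hv
  have hv0 : 0 < v := Real.rpow_pos_of_pos hn0 _
  set u := n ^ (-(1 / 2) : ℝ) with hu
  have hu0 : 0 < u := Real.rpow_pos_of_pos hn0 _
  set N := n ^ (1 / 2 - 2 * e) with hN
  have hN0 : 0 < N := Real.rpow_pos_of_pos hn0 _
  have hIco : ∀ t ∈ Icc 0 x, t ∈ Ico (0 : ℝ) 1 := fun t ht => ⟨ht.1, by linarith [ht.2, hx.2]⟩
  have hpw : ∀ s : ℝ, s ≤ 0 → ∀ t ∈ Icc 0 x, (1 - t) ^ s ≤ c ^ s * n ^ (-2 * s) := by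
    intro s hs t ht
    have : (1 - t) ^ s ≤ (c / n ^ 2) ^ s :=
      Real.rpow_le_rpow_of_nonpos hcn0 (by linarith [ht.2, hx.2]) hs
    refine this.trans (le_of_eq ?_)
    rw [Real.div_rpow hc0.le (by positivity), ← Real.rpow_natCast, ← Real.rpow_mul hn0.le, div_eq_mul_inv,
      ← Real.rpow_neg hn0.le]
    congr 2; push_cast; ring
  have hvN : v * n ^ (-2 * e) = N := by rw [hv, hN, ← Real.rpow_add hn0]; congr 1; ring
  have huN : u * n ^ (-2 * (-f)) = N := by rw [hu, hN, ← Real.rpow_add hn0, hf]; congr 1; ring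
  have hA : ∀ t ∈ Icc 0 x, |(1 - t) ^ (δ + 1) * (1 + t) ^ (γ + 1) * Q.derivative.eval t| ≤ K1 * c ^ e * N := by
    intro t ht
    refine (AA_bound α γ δ C v hC.le hv0.le Q t (hIco t ht) (hb t ⟨ht.1, ht.2.trans hx.2⟩).2).trans ?_
    rw [← he, ← hK1]
    calc K1 * v * (1 - t) ^ e ≤ K1 * v * (c ^ e * n ^ (-2 * e)) := by gcongr; exact hpw e hε t ht
      _ = _ := by rw [← hvN]; ring
  have hB : ∀ t ∈ Icc 0 x, |(1 - t) ^ δ * (1 + t) ^ γ * ((α - δ) * (1 + t) + (γ - β) * (1 - t)) * Q.eval t|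
      ≤ K2 * c ^ (-f) * N := by
    intro t ht
    have h1 : 0 < 1 - t := by linarith [(hIco t ht).2]
    have h2 : 0 < 1 + t := by linarith [(hIco t ht).1]
    have p1 := Real.rpow_pos_of_pos h1 δ
    have p2 := Real.rpow_pos_of_pos h2 γ
    have b2 := one_add_rpow_le γ t ht.1 (hIco t ht).2.le
    have b3 := lin_bound (α - δ) (γ - β) t ht.1 (hIco t ht).2.le
    have b4 := (hb t ⟨ht.1, ht.2.trans hx.2⟩).1
    rw [abs_mul, abs_mul, abs_mul, abs_of_pos p1, abs_of_pos p2]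
    calc (1 - t) ^ δ * (1 + t) ^ γ * |(α - δ) * (1 + t) + (γ - β) * (1 - t)| * |Q.eval t|
        ≤ (1 - t) ^ δ * 2 ^ |γ| * (2 * (|α - δ| + |γ - β|)) * (C * u * (1 - t) ^ (-α / 2 - 1 / 4)) := by
          gcongr
      _ = K2 * u * ((1 - t) ^ δ * (1 - t) ^ (-α / 2 - 1 / 4)) := by rw [hK2]; ring
      _ = K2 * u * (1 - t) ^ (-f) := by rw [← Real.rpow_add h1, hf, he]; congr 2; ring
      _ ≤ K2 * u * (c ^ (-f) * n ^ (-2 * (-f))) := by gcongr; exact hpw (-f) (by linarith) t ht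
      _ = _ := by rw [← huN]; ring
  set A := fun t => (1 - t) ^ (δ + 1) * (1 + t) ^ (γ + 1) * Q.derivative.eval t with hAd
  set B := fun t => (1 - t) ^ δ * (1 + t) ^ γ * ((α - δ) * (1 + t) + (γ - β) * (1 - t)) * Q.eval t with hBd
  have dΦ : ∀ t ∈ Icc 0 x, HasDerivAt
      (fun t => l * FF γ δ Q t + A t - B t)
      (-((1 - t) ^ (δ - 1) * (1 + t) ^ (γ - 1) * ((-δ * (1 + t) + γ * (1 - t)) *
          ((α - δ) * (1 + t) + (γ - β) * (1 - t)) + (1 - t) * (1 + t) * (α - δ - (γ - β))) * Q.eval t)) t := by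
    intro t ht
    refine ((((FF_deriv γ δ hδ Q t (hIco t ht)).const_mul l).add
      (AA_deriv α β γ δ l Q hQ t (hIco t ht))).sub (BB_deriv α β γ δ Q t (hIco t ht))).congr_deriv ?_
    ring
  have dΨ : ∀ t ∈ Icc 0 x, HasDerivAt (fun t => (K3 * u / f) * (1 - t) ^ (-f)) (K3 * u * (1 - t) ^ (-f - 1)) t := by
    intro t ht
    have h1 : 0 < 1 - t := by linarith [(hIco t ht).2]
    refine ((((hasDerivAt_id t).const_sub 1).rpow_const (p := -f) (Or.inl h1.ne')).const_mul _).congr_deriv ?_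
    simp only [id]
    field_simp
  have hc := compare _ _ _ _ 0 x hx.1 (fun t ht => (dΦ t ht).continuousAt.continuousWithinAt)
    (fun t ht => (dΨ t ht).continuousAt.continuousWithinAt) (fun t ht => dΦ t (Ioo_subset_Icc_self ht))
    (fun t ht => dΨ t (Ioo_subset_Icc_self ht)) ?_
  · have hF0 : FF γ δ Q 0 = 0 := by simp [FF]
    simp only [hF0] at hc
    have a1 : |A 0| ≤ _ := hA 0 ⟨le_rfl, hx.1⟩
    have a2 : |A x| ≤ _ := hA x ⟨hx.1, le_rfl⟩
    have a3 : |B 0| ≤ _ := hB 0 ⟨le_rfl, hx.1⟩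
    have a4 : |B x| ≤ _ := hB x ⟨hx.1, le_rfl⟩
    have hp : 0 ≤ K3 * u / f * (1 - 0) ^ (-f) := by
      rw [sub_zero, Real.one_rpow]
      positivity
    have hq : K3 * u / f * (1 - x) ^ (-f) ≤ K3 / f * c ^ (-f) * N := by
      calc K3 * u / f * (1 - x) ^ (-f) ≤ K3 * u / f * (c ^ (-f) * n ^ (-2 * (-f))) := by
            gcongr; exact hpw (-f) (by linarith) x ⟨hx.1, le_rfl⟩
        _ = _ := by rw [← huN]; ring
    have hlF : |l * FF γ δ Q x| ≤ (2 * (K1 * c ^ e) + 2 * (K2 * c ^ (-f)) + K3 / f * c ^ (-f)) * N := by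
      have e1 : l * FF γ δ Q x = (l * FF γ δ Q x + A x - B x - (l * 0 + A 0 - B 0)) + (A 0 - B 0) - (A x - B x) := by ring
      rw [e1]
      have := abs_sub (l * FF γ δ Q x + A x - B x - (l * 0 + A 0 - B 0) + (A 0 - B 0)) (A x - B x)
      have := abs_add_le (l * FF γ δ Q x + A x - B x - (l * 0 + A 0 - B 0)) (A 0 - B 0)
      have := abs_sub (A 0) (B 0)
      have := abs_sub (A x) (B x)
      linarith
    rw [abs_mul, abs_of_pos hl0] at hlF
    have e3 : N = n ^ 2 * n ^ (-(2 * δ - α + 2)) := by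
      rw [← Real.rpow_natCast, ← Real.rpow_add hn0, hN, he]; congr 1; push_cast; ring
    set K := (2 * (K1 * c ^ e) + 2 * (K2 * c ^ (-f)) + K3 / f * c ^ (-f))
    have h3 : n ^ 2 / 2 * |FF γ δ Q x| ≤ K * (n ^ 2 * n ^ (-(2 * δ - α + 2))) := by
      rw [← e3]
      exact (mul_le_mul_of_nonneg_right hl (abs_nonneg _)).trans hlF
    have h4 : n ^ 2 * |FF γ δ Q x| ≤ n ^ 2 * (2 * K * n ^ (-(2 * δ - α + 2))) := by linarith
    exact le_of_mul_le_mul_left h4 (by positivity)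
  · intro t ht
    have ht := Ioo_subset_Icc_self ht
    have h1 : 0 < 1 - t := by linarith [(hIco t ht).2]
    have h2 : 0 < 1 + t := by linarith [(hIco t ht).1]
    have p1 := Real.rpow_pos_of_pos h1 (δ - 1)
    have p2 := Real.rpow_pos_of_pos h2 (γ - 1)
    have b2 := one_add_rpow_le (γ - 1) t ht.1 (hIco t ht).2.le
    have b3 := lin_bound (α - δ) (γ - β) t ht.1 (hIco t ht).2.le
    have b3' := lin_bound (-δ) γ t ht.1 (hIco t ht).2.le
    rw [abs_neg] at b3'
    have b4 := (hb t ⟨ht.1, ht.2.trans hx.2⟩).1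
    have b5 : |(-δ * (1 + t) + γ * (1 - t)) *
          ((α - δ) * (1 + t) + (γ - β) * (1 - t)) + (1 - t) * (1 + t) * (α - δ - (γ - β))| ≤
        (2 * (|δ| + |γ|)) * (2 * (|α - δ| + |γ - β|)) + |α - δ - (γ - β)| := by
      refine (abs_add_le _ _).trans (add_le_add ?_ ?_)
      · rw [abs_mul]; gcongr
      · rw [abs_mul]
        refine mul_le_of_le_one_left (abs_nonneg _) ?_
        rw [abs_of_pos (by positivity)]
        nlinarith [sq_nonneg t]
    rw [abs_neg, abs_mul, abs_mul, abs_mul, abs_of_pos p1, abs_of_pos p2]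
    calc _ ≤ (1 - t) ^ (δ - 1) * 2 ^ |γ - 1| * ((2 * (|δ| + |γ|)) * (2 * (|α - δ| + |γ - β|)) + |α - δ - (γ - β)|)
          * (C * u * (1 - t) ^ (-α / 2 - 1 / 4)) := by
          gcongr
      _ = K3 * u * ((1 - t) ^ (δ - 1) * (1 - t) ^ (-α / 2 - 1 / 4)) := by rw [hK3]; ring
      _ = _ := by rw [← Real.rpow_add h1, hf, he]; congr 2; ring

lemma nearInt (α γ δ C c : ℝ) (hδ : -1 < δ) (hC : 0 < C) (hc0 : 0 < c) (hc1 : c < 1) :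
    ∃ K : ℝ, 0 < K ∧ ∀ n : ℝ, 1 ≤ n → ∀ Q : Polynomial ℝ,
      (∀ x ∈ Icc (1 - c / n ^ 2) 1, |Q.eval x| ≤ C * n ^ α) →
      ∀ x ∈ Icc (1 - c / n ^ 2) 1,
        |FF γ δ Q x - FF γ δ Q (1 - c / n ^ 2)| ≤ K * n ^ (-(2 * δ - α + 2)) := by
  have hd : 0 < δ + 1 := by linarith
  obtain ⟨K1, hK1⟩ : ∃ K : ℝ, K = 2 ^ |γ| * C := ⟨_, rfl⟩
  have hK10 : 0 < K1 := by rw [hK1]; positivity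
  refine ⟨K1 / (δ + 1) * c ^ (δ + 1), by positivity, ?_⟩
  intro n hn Q hb x hx
  have hn0 : 0 < n := by linarith
  have hcn0 : 0 < c / n ^ 2 := by positivity
  have hcn : c / n ^ 2 < 1 := by
    rw [div_lt_iff₀ (by positivity)]; nlinarith
  have hnα := Real.rpow_pos_of_pos hn0 α
  have hIco : ∀ t ∈ Ioo (1 - c / n ^ 2) x, t ∈ Ico (0 : ℝ) 1 := fun t ht =>
    ⟨by linarith [ht.1], by linarith [ht.2, hx.2]⟩
  have dΨ : ∀ t ∈ Ioo (1 - c / n ^ 2) x, HasDerivAt (fun t => -(K1 * n ^ α / (δ + 1)) * (1 - t) ^ (δ + 1))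
      (K1 * n ^ α * (1 - t) ^ δ) t := by
    intro t ht
    have h1 : 0 < 1 - t := by linarith [(hIco t ht).2]
    refine ((((hasDerivAt_id t).const_sub 1).rpow_const (p := δ + 1) (Or.inl h1.ne')).const_mul _).congr_deriv ?_
    simp only [id, add_sub_cancel_right]
    field_simp
  have hc := compare (FF γ δ Q) _ _ _ (1 - c / n ^ 2) x hx.1
    ((FF_cont γ δ hδ Q).mono (Icc_subset_Icc (by linarith) hx.2))
    (continuousOn_const.mul
        ((continuousOn_const.sub continuousOn_id).rpow_const (fun t _ => Or.inr hd.le)))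
    (fun t ht => FF_deriv γ δ hδ Q t (hIco t ht)) dΨ ?_
  · refine hc.trans ?_
    simp only [Pi.mul_apply, Pi.sub_apply, id]
    have h1 : 0 ≤ K1 * n ^ α / (δ + 1) * (1 - x) ^ (δ + 1) := by
      have := Real.rpow_nonneg (by linarith [hx.2] : 0 ≤ 1 - x) (δ + 1)
      positivity
    have h2 : K1 * n ^ α / (δ + 1) * (1 - (1 - c / n ^ 2)) ^ (δ + 1) =
        K1 / (δ + 1) * c ^ (δ + 1) * n ^ (-(2 * δ - α + 2)) := by
      rw [sub_sub_cancel, Real.div_rpow hc0.le (by positivity), ← Real.rpow_natCast, ← Real.rpow_mul hn0.le,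
        div_eq_mul_inv (c ^ (δ + 1)), ← Real.rpow_neg hn0.le]
      have : n ^ (-(2 * δ - α + 2)) = n ^ α * n ^ (-(((2 : ℕ) : ℝ) * (δ + 1))) := by
        rw [← Real.rpow_add hn0]; congr 1; push_cast; ring
      rw [this]; ring
    linarith
  · intro t ht
    have h1 : 0 < 1 - t := by linarith [(hIco t ht).2]
    have h2 : 0 < 1 + t := by linarith [(hIco t ht).1]
    have p1 := Real.rpow_pos_of_pos h1 δ
    have p2 := Real.rpow_pos_of_pos h2 γ
    have b2 := one_add_rpow_le γ t (hIco t ht).1 (hIco t ht).2.le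
    have b4 := hb t ⟨ht.1.le, (hIco t ht).2.le⟩
    rw [kk, abs_mul, abs_mul, abs_of_pos p1, abs_of_pos p2]
    calc _ ≤ (1 - t) ^ δ * 2 ^ |γ| * (C * n ^ α) := by gcongr
      _ = _ := by rw [hK1]; ring

lemma FF_bound (α β γ δ : ℝ) (hα : -1 < α) (hβ : -1 < β) (hδ : -1 < δ) : ∃ K : ℝ, 0 < K ∧
    ∀ n l : ℝ, 1 ≤ n → n ^ 2 / 2 ≤ l → l ≤ 2 * n ^ 2 → ∀ Q, ODE α β l Q →
      |Q.eval 1| ≤ Real.exp |α| * n ^ α →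
      ∀ x ∈ Icc (0 : ℝ) 1, |FF γ δ Q x| ≤ K * n ^ (-(min (2 * δ - α + 2) (3 / 2))) := by
  obtain ⟨c, C, hc0, hc1, hC, hest⟩ := est α β hα hβ
  have hfar : ∃ K : ℝ, 0 < K ∧ ∀ n l : ℝ, 1 ≤ n → n ^ 2 / 2 ≤ l → ∀ Q, ODE α β l Q →
      (∀ x ∈ Icc 0 (1 - c / n ^ 2),
        |Q.eval x| ≤ C * n ^ (-(1 / 2) : ℝ) * (1 - x) ^ (-α / 2 - 1 / 4) ∧
        |Q.derivative.eval x| ≤ C * n ^ (1 / 2 : ℝ) * (1 - x) ^ (-α / 2 - 3 / 4)) →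
      ∀ x ∈ Icc 0 (1 - c / n ^ 2), |FF γ δ Q x| ≤ K * n ^ (-(min (2 * δ - α + 2) (3 / 2))) := by
    rcases lt_or_ge 0 (δ - α / 2 + 1 / 4) with h | h
    · rw [min_eq_right (by linarith)]
      obtain ⟨K, hK, hh⟩ := farInt_pos α β γ δ C hδ hC h
      refine ⟨K, hK, fun n l hn hl Q hQ hb => hh n l (1 - c / n ^ 2) hn hl ?_ Q hQ (fun x hx => (hb x hx).2)⟩
      have : 0 < n := by linarith
      have : 0 < c / n ^ 2 := by positivity
      linarith
    · rw [min_eq_left (by linarith)]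
      exact farInt_neg α β γ δ C c hδ hC hc0 h
  obtain ⟨K1, hK1, hf⟩ := hfar
  obtain ⟨K2, hK2, hnr⟩ := nearInt α γ δ C c hδ hC hc0 hc1
  refine ⟨K1 + K2, by positivity, ?_⟩
  intro n l hn hl1 hl2 Q hQ hQ1 x hx
  have hn0 : 0 < n := by linarith
  have hcn : c / n ^ 2 < 1 := by
    rw [div_lt_iff₀ (by positivity)]; nlinarith
  have hcn0 : 0 < c / n ^ 2 := by positivity
  obtain ⟨e1, e2⟩ := hest n l hn hl1 hl2 Q hQ hQ1
  have f1 := hf n l hn hl1 Q hQ e2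
  have hp := Real.rpow_pos_of_pos hn0 (-(min (2 * δ - α + 2) (3 / 2)))
  rcases le_total x (1 - c / n ^ 2) with h | h
  · refine (f1 x ⟨hx.1, h⟩).trans ?_
    gcongr; linarith
  · have g1 := f1 (1 - c / n ^ 2) ⟨by linarith, le_rfl⟩
    have g2 := hnr n hn Q e1 x ⟨h, hx.2⟩
    have g3 : n ^ (-(2 * δ - α + 2)) ≤ n ^ (-(min (2 * δ - α + 2) (3 / 2))) :=
      Real.rpow_le_rpow_of_exponent_le hn (neg_le_neg (min_le_left _ _))
    have g4 : K2 * n ^ (-(2 * δ - α + 2)) ≤ K2 * n ^ (-(min (2 * δ - α + 2) (3 / 2))) := by gcongr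
    have g5 := abs_add_le (FF γ δ Q x - FF γ δ Q (1 - c / n ^ 2)) (FF γ δ Q (1 - c / n ^ 2))
    rw [sub_add_cancel] at g5
    linarith


lemma half_parts (k g φ : ℝ → ℝ) (S : ℝ) (hk : IntervalIntegrable k volume 0 1)
    (hS : ∀ x ∈ Icc (0 : ℝ) 1, |∫ t in (0 : ℝ)..x, k t| ≤ S)
    (hφ : IntervalIntegrable φ volume 0 1)
    (hg : ∀ x ∈ Icc (0 : ℝ) 1, g x = g 0 + ∫ t in (0 : ℝ)..x, φ t) :
    IntervalIntegrable (fun x => k x * g x) volume 0 1 ∧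
    |∫ x in (0 : ℝ)..1, k x * g x| ≤ S * (|g 1| + ∫ x in (0 : ℝ)..1, |φ x|) := by
  have h01 : (0 : ℝ) ∈ uIcc (0 : ℝ) 1 := by simp
  have hFac := hk.absolutelyContinuousOnInterval_intervalIntegral h01
  have hGac := hφ.absolutelyContinuousOnInterval_intervalIntegral h01
  set F : ℝ → ℝ := fun x => ∫ t in (0 : ℝ)..x, k t with hF
  set G : ℝ → ℝ := fun x => ∫ t in (0 : ℝ)..x, φ t with hG
  have ibp := hFac.integral_mul_deriv_eq_deriv_mul hGac
  have e1 : ∫ x in (0 : ℝ)..1, F x * deriv G x = ∫ x in (0 : ℝ)..1, F x * φ x := by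
    apply intervalIntegral.integral_congr_ae
    filter_upwards [hφ.ae_hasDerivAt_integral] with x hx hx'
    rw [(hx (uIoc_subset_uIcc hx') 0 h01).deriv]
  have e2 : ∫ x in (0 : ℝ)..1, deriv F x * G x = ∫ x in (0 : ℝ)..1, k x * G x := by
    apply intervalIntegral.integral_congr_ae
    filter_upwards [hk.ae_hasDerivAt_integral] with x hx hx'
    rw [(hx (uIoc_subset_uIcc hx') 0 h01).deriv]
  rw [e1, e2] at ibp
  have hgG : ∀ x ∈ uIcc (0 : ℝ) 1, k x * g x = g 0 * k x + k x * G x := by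
    intro x hx
    rw [uIcc_of_le zero_le_one] at hx
    rw [hg x hx]; ring
  have ikG : IntervalIntegrable (fun x => k x * G x) volume 0 1 := hk.mul_continuousOn hGac.continuousOn
  have ikg : IntervalIntegrable (fun x => g 0 * k x + k x * G x) volume 0 1 := (hk.const_mul _).add ikG
  refine ⟨ikg.congr (fun x hx => (hgG x (uIoc_subset_uIcc hx)).symm), ?_⟩
  have hG0 : G 0 = 0 := by simp [hG]
  have hF0 : F 0 = 0 := by simp [hF]
  have e3 : ∫ x in (0 : ℝ)..1, k x * g x = F 1 * g 1 - ∫ x in (0 : ℝ)..1, F x * φ x := by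
    rw [intervalIntegral.integral_congr hgG, intervalIntegral.integral_add (hk.const_mul _) ikG,
      intervalIntegral.integral_const_mul, ibp, hg 1 (by simp), hF0]
    simp only [hF, hG]
    ring
  have hS1 := hS 1 (by simp)
  have b1 : |∫ x in (0 : ℝ)..1, F x * φ x| ≤ S * ∫ x in (0 : ℝ)..1, |φ x| := by
    rw [← intervalIntegral.integral_const_mul, ← Real.norm_eq_abs]
    refine intervalIntegral.norm_integral_le_of_norm_le zero_le_one ?_ (hφ.abs.const_mul S)
    filter_upwards with x hx
    rw [Real.norm_eq_abs, abs_mul]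
    exact mul_le_mul_of_nonneg_right (hS x ⟨hx.1.le, hx.2⟩) (abs_nonneg _)
  have b2 : |F 1 * g 1| ≤ S * |g 1| := by
    rw [abs_mul]; exact mul_le_mul_of_nonneg_right hS1 (abs_nonneg _)
  rw [e3]
  calc |F 1 * g 1 - ∫ x in (0 : ℝ)..1, F x * φ x| ≤ |F 1 * g 1| + |∫ x in (0 : ℝ)..1, F x * φ x| := abs_sub _ _
    _ ≤ _ := by linarith

lemma half_main (α β γ δ : ℝ) (hα : -1 < α) (hβ : -1 < β) (hδ : -1 < δ) :
    ∃ K : ℝ, 0 < K ∧ ∃ N : ℕ, 1 ≤ N ∧ ∀ n : ℕ, N ≤ n → ∀ g φ : ℝ → ℝ,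
      IntervalIntegrable φ volume 0 1 → (∀ x ∈ Icc (0 : ℝ) 1, g x = g 0 + ∫ t in (0 : ℝ)..x, φ t) →
      IntervalIntegrable (fun x => (1 + x) ^ γ * (1 - x) ^ δ * jacobiP α β n x * g x) volume 0 1 ∧
      |∫ x in (0 : ℝ)..1, (1 + x) ^ γ * (1 - x) ^ δ * jacobiP α β n x * g x| ≤
        K * (n : ℝ) ^ (-(min (2 * δ - α + 2) (3 / 2))) * (|g 1| + ∫ x in (0 : ℝ)..1, |φ x|) := by
  obtain ⟨K, hK, hb⟩ := FF_bound α β γ δ hα hβ hδ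
  refine ⟨K, hK, max 1 ⌈2 * |α + β + 1|⌉₊, le_max_left _ _, ?_⟩
  intro n hn g φ hφ hg
  have hn1 : 1 ≤ n := (le_max_left _ _).trans hn
  have hn1' : (1 : ℝ) ≤ n := by exact_mod_cast hn1
  have hn2 : 2 * |α + β + 1| ≤ n := (Nat.le_ceil _).trans (by exact_mod_cast (le_max_right _ _).trans hn)
  obtain ⟨Q, hQ, hQ1, hode⟩ := jacobi_poly α β hα n hn1
  have ha := abs_le.mp (le_refl |α + β + 1|)
  have hl1 : (n : ℝ) ^ 2 / 2 ≤ n * (n + α + β + 1) := by nlinarith [ha.1]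
  have hl2 : (n : ℝ) * (n + α + β + 1) ≤ 2 * (n : ℝ) ^ 2 := by nlinarith [ha.2]
  have hbb := hb n _ hn1' hl1 hl2 Q hode hQ1
  obtain ⟨h1, h2⟩ := half_parts (kk γ δ Q) g φ _ (kk_int γ δ hδ Q) hbb hφ hg
  have hae : ∀ᵐ x ∂(volume : Measure ℝ), x ∈ uIoc (0 : ℝ) 1 →
      (1 + x) ^ γ * (1 - x) ^ δ * jacobiP α β n x * g x = kk γ δ Q x * g x := by
    have : ∀ᵐ x ∂(volume : Measure ℝ), x ≠ 1 := by simp [ae_iff, measure_singleton]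
    filter_upwards [this] with x hx hx'
    rw [uIoc_of_le zero_le_one] at hx'
    rw [hQ x ⟨by linarith [hx'.1], lt_of_le_of_ne hx'.2 hx⟩, kk]
    ring
  constructor
  · refine h1.congr_ae ?_
    rw [Filter.EventuallyEq, ae_restrict_iff' measurableSet_uIoc]
    filter_upwards [hae] with x hx hx'
    exact (hx hx').symm
  · rw [intervalIntegral.integral_congr_ae hae]
    exact h2

lemma final (α β γ δ : ℝ) (hα : -1 < α) (hβ : -1 < β)
    (hγ : -1 < γ) (hδ : -1 < δ) :
    ∃ C : ℝ, 0 < C ∧ ∃ N : ℕ, ∀ ψ : ℝ → ℝ, IsWAC (-1) 1 ψ → ∀ n : ℕ, N ≤ n →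
      |∫ x in (-1 : ℝ)..1, (1 + x) ^ γ * (1 - x) ^ δ * jacobiP α β n x * ψ x| ≤
        C * wacNorm (-1) 1 ψ *
          (n : ℝ) ^ (-(min (2 * δ - α + 2) (min (2 * γ - β + 2) (3 / 2)))) := by
  obtain ⟨K1, hK1, N1, hN1, H1⟩ := half_main α β γ δ hα hβ hδ
  obtain ⟨K2, hK2, N2, hN2, H2⟩ := half_main β α δ γ hβ hα hγ
  refine ⟨K1 + K2, by positivity, max N1 N2, ?_⟩
  intro ψ hψ n hn
  obtain ⟨hIoo, hft⟩ := hψ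
  have hn1 : N1 ≤ n := (le_max_left _ _).trans hn
  have hn2 : N2 ≤ n := (le_max_right _ _).trans hn
  have hn1' : (1 : ℝ) ≤ n := by exact_mod_cast hN1.trans hn1
  have hI : IntervalIntegrable (deriv ψ) volume (-1) 1 := by
    rw [intervalIntegrable_iff_integrableOn_Ioo_of_le (by norm_num)]
    exact hIoo
  have hsub : ∀ a b : ℝ, a ∈ Icc (-1 : ℝ) 1 → b ∈ Icc (-1 : ℝ) 1 → IntervalIntegrable (deriv ψ) volume a b := by
    intro a b ha hb
    refine hI.mono_set ?_
    rw [uIcc_of_le (by norm_num : (-1 : ℝ) ≤ 1)]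
    exact uIcc_subset_Icc ha hb
  have m1 : (-1 : ℝ) ∈ Icc (-1 : ℝ) 1 := by norm_num
  have m0 : (0 : ℝ) ∈ Icc (-1 : ℝ) 1 := by norm_num
  have mp : (1 : ℝ) ∈ Icc (-1 : ℝ) 1 := by norm_num
  have hft0 : ∀ x ∈ Icc (-1 : ℝ) 1, ψ x = ψ 0 + ∫ t in (0 : ℝ)..x, deriv ψ t := by
    intro x hx
    have := intervalIntegral.integral_add_adjacent_intervals (hsub (-1) 0 m1 m0) (hsub 0 x m0 hx)
    rw [hft x hx, hft 0 m0]
    linarith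
  obtain ⟨i1, b1⟩ := H1 n hn1 ψ (deriv ψ) (hsub 0 1 m0 mp)
    (fun x hx => hft0 x ⟨by linarith [hx.1], hx.2⟩)
  have hφ2 : IntervalIntegrable (fun t => -deriv ψ (-t)) volume 0 1 := by
    have := ((hsub 0 (-1) m0 m1).comp_sub_left 0).neg
    simpa [Pi.neg_def] using this
  obtain ⟨i2, b2⟩ := H2 n hn2 (fun x => ψ (-x)) (fun t => -deriv ψ (-t)) hφ2 (by
    intro x hx
    have h := hft0 (-x) ⟨by linarith [hx.2], by linarith [hx.1]⟩
    simp only [neg_zero]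
    rw [h, intervalIntegral.integral_neg, intervalIntegral.integral_comp_neg (fun t => deriv ψ t), neg_zero,
      intervalIntegral.integral_symm (-x) 0])
  set f : ℝ → ℝ := fun x => (1 + x) ^ γ * (1 - x) ^ δ * jacobiP α β n x * ψ x with hf
  have hfl : ∀ x, (1 + x) ^ δ * (1 - x) ^ γ * jacobiP β α n x * ψ (-x) = (-1) ^ n * f (-x) := by
    intro x
    have hs : (-1 : ℝ) ^ n * (-1) ^ n = 1 := by rw [← mul_pow]; norm_num
    simp only [hf]
    rw [jacobi_symm, sub_neg_eq_add, ← sub_eq_add_neg]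
    linear_combination (-((1 + x) ^ δ * (1 - x) ^ γ * jacobiP β α n x * ψ (-x))) * hs
  have hfl2 : ∀ x, f x = (-1) ^ n * ((1 + -x) ^ δ * (1 - -x) ^ γ * jacobiP β α n (-x) * ψ (- -x)) := by
    intro x
    have hs : (-1 : ℝ) ^ n * (-1) ^ n = 1 := by rw [← mul_pow]; norm_num
    rw [hfl, neg_neg, ← mul_assoc, hs, one_mul]
  have il : IntervalIntegrable f volume (-1) 0 := by
    have h := (i2.symm.comp_sub_left 0).const_mul ((-1) ^ n)
    simp only [zero_sub, sub_zero] at h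
    exact h.congr (fun x _ => (hfl2 x).symm)
  have el : |∫ x in (-1 : ℝ)..0, f x| = |∫ x in (0 : ℝ)..1, (1 + x) ^ δ * (1 - x) ^ γ * jacobiP β α n x * ψ (-x)| := by
    simp_rw [hfl]
    rw [intervalIntegral.integral_const_mul, intervalIntegral.integral_comp_neg f, neg_zero, abs_mul,
      abs_pow, abs_neg, abs_one, one_pow, one_mul]
  have hsplit := intervalIntegral.integral_add_adjacent_intervals il i1
  have hcont : ContinuousOn ψ (Icc (-1) 1) := by
    have h := intervalIntegral.continuousOn_primitive_interval' hI (a := -1) (by simp)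
    rw [uIcc_of_le (by norm_num : (-1 : ℝ) ≤ 1)] at h
    exact (continuousOn_const.add h).congr (fun x hx => hft x hx)
  have hbdd : BddAbove (range (fun x : Icc (-1 : ℝ) 1 => |ψ x|)) := by
    have := (isCompact_Icc.image_of_continuousOn hcont.abs).bddAbove
    rwa [image_eq_range] at this
  set M := ⨆ x : Icc (-1 : ℝ) 1, |ψ (x : ℝ)| with hM
  have s1 : |ψ 1| ≤ M := le_ciSup hbdd ⟨1, mp⟩
  have s2 : |ψ (-1)| ≤ M := le_ciSup hbdd ⟨-1, m1⟩
  have hM0 : 0 ≤ M := (abs_nonneg _).trans s1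
  have habs := intervalIntegral.integral_add_adjacent_intervals (hsub (-1) 0 m1 m0).abs (hsub 0 1 m0 mp).abs
  have p1 : 0 ≤ ∫ t in (-1 : ℝ)..0, |deriv ψ t| :=
    intervalIntegral.integral_nonneg (by norm_num) (fun _ _ => abs_nonneg _)
  have p2 : 0 ≤ ∫ t in (0 : ℝ)..1, |deriv ψ t| :=
    intervalIntegral.integral_nonneg (by norm_num) (fun _ _ => abs_nonneg _)
  have e2 : ∫ t in (0 : ℝ)..1, |(-deriv ψ (-t))| = ∫ t in (-1 : ℝ)..0, |deriv ψ t| := by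
    simp_rw [abs_neg]
    rw [intervalIntegral.integral_comp_neg (fun t => |deriv ψ t|), neg_zero]
  rw [e2] at b2
  have hW : wacNorm (-1) 1 ψ = M + ∫ t in (-1 : ℝ)..1, |deriv ψ t| := rfl
  set E := (n : ℝ) ^ (-(min (2 * δ - α + 2) (min (2 * γ - β + 2) (3 / 2)))) with hE
  have hE0 : 0 ≤ E := by positivity
  have r1 : (n : ℝ) ^ (-(min (2 * δ - α + 2) (3 / 2))) ≤ E := by
    apply Real.rpow_le_rpow_of_exponent_le hn1'
    apply neg_le_neg
    exact min_le_min le_rfl (min_le_right _ _)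
  have r2 : (n : ℝ) ^ (-(min (2 * γ - β + 2) (3 / 2))) ≤ E := by
    apply Real.rpow_le_rpow_of_exponent_le hn1'
    apply neg_le_neg
    exact min_le_right _ _
  have c1 : |∫ x in (0 : ℝ)..1, f x| ≤ K1 * E * wacNorm (-1) 1 ψ := by
    refine b1.trans ?_
    have : |ψ 1| + ∫ x in (0 : ℝ)..1, |deriv ψ x| ≤ wacNorm (-1) 1 ψ := by rw [hW]; linarith
    gcongr
  have c2 : |∫ x in (-1 : ℝ)..0, f x| ≤ K2 * E * wacNorm (-1) 1 ψ := by
    rw [el]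
    refine b2.trans ?_
    have : |ψ (-1)| + ∫ x in (-1 : ℝ)..0, |deriv ψ x| ≤ wacNorm (-1) 1 ψ := by rw [hW]; linarith
    gcongr
  rw [← hsplit]
  refine (abs_add_le _ _).trans ?_
  linarith

end VdC


theorem van_der_corput_jacobi_boundary (α β γ δ : ℝ) (hα : -1 < α) (hβ : -1 < β)
    (hγ : -1 < γ) (hδ : -1 < δ) :
    ∃ C : ℝ, 0 < C ∧ ∃ N : ℕ, ∀ ψ : ℝ → ℝ, IsWAC (-1) 1 ψ → ∀ n : ℕ, N ≤ n →
      |∫ x in (-1 : ℝ)..1, (1 + x) ^ γ * (1 - x) ^ δ * jacobiP α β n x * ψ x| ≤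
        C * wacNorm (-1) 1 ψ *
          (n : ℝ) ^ (-(min (2 * δ - α + 2) (min (2 * γ - β + 2) (3 / 2)))) := by
  exact VdC.final α β γ δ hα hβ hγ hδ
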